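/- For all reals c > 0 and all integers k ≥ 1, b ≥ 1, there exists n₀ such that the following holds: for every directed graph G with n ≥ n₀ vertices and m edges, with nonnegative integer edge lengths at most n^k, and for every ε with 1/(log₂ n)^b ≤ ε < 1, there exists a (1+ε)-distance-preserving DAG projection D onto G of width at most n^c; consequently D has at most n^{1+c} vertices and at most m·n^{2c} edges. -/

import Mathlib

open scoped Classical ENNReal

/-- `IsWalk E s t l`: `l` is the list of successive vertices (after `s`) of a
directed walk from `s` to `t` in the graph with edge relation `E`. -/
def IsWalk {V : Type*} (E : V → V → Prop) : V → V → List V → Prop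
  | s, t, [] => s = t
  | s, t, v :: rest => E s v ∧ IsWalk E v t rest

/-- Total length of the walk starting at `s` with successive vertices `l`. -/
def walkLen {V : Type*} (ℓ : V → V → ℕ) : V → List V → ℕ
  | _, [] => 0
  | s, v :: rest => ℓ s v + walkLen ℓ v rest

/-- Shortest-path distance from `s` to `t` (`∞` if `t` is unreachable from `s`). -/
noncomputable def gdist {V : Type*} (E : V → V → Prop) (ℓ : V → V → ℕ) (s t : V) : ℝ≥0∞ :=
  ⨅ (l : List V) (_ : IsWalk E s t l), (walkLen ℓ s l : ℝ≥0∞)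

/-- Set-to-set shortest-path distance. -/
noncomputable def gdistSet {V : Type*} (E : V → V → Prop) (ℓ : V → V → ℕ)
    (A B : Set V) : ℝ≥0∞ :=
  ⨅ (a ∈ A) (b ∈ B), gdist E ℓ a b

/-- A directed graph is acyclic (a DAG). -/
def IsDag {V : Type*} (E : V → V → Prop) : Prop := ∀ x : V, ¬ Relation.TransGen E x x


section Walks
variable {V : Type*} {E : V → V → Prop}

theorem isWalk_append {s u t : V} {l1 l2 : List V} (h1 : IsWalk E s u l1)
    (h2 : IsWalk E u t l2) : IsWalk E s t (l1 ++ l2) := by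
  induction l1 generalizing s with
  | nil => simp only [IsWalk] at h1; subst h1; exact h2
  | cons v l ih => exact ⟨h1.1, ih h1.2⟩

theorem walkLen_append (g : V → V → ℕ) {s u : V} {l1 l2 : List V} (h1 : IsWalk E s u l1) :
    walkLen g s (l1 ++ l2) = walkLen g s l1 + walkLen g u l2 := by
  induction l1 generalizing s with
  | nil => simp only [IsWalk] at h1; subst h1; simp [walkLen]
  | cons v l ih => simp only [List.cons_append, walkLen, ih h1.2]; ring

theorem isWalk_split {s t y : V} {l : List V} (h : IsWalk E s t l) (hy : y ∈ s :: l) :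
    ∃ l1 l2, l = l1 ++ l2 ∧ IsWalk E s y l1 ∧ IsWalk E y t l2 := by
  induction l generalizing s with
  | nil =>
    simp only [List.mem_singleton] at hy; subst hy
    exact ⟨[], [], rfl, rfl, h⟩
  | cons v l ih =>
    rcases List.mem_cons.1 hy with rfl | hy
    · exact ⟨[], v :: l, rfl, rfl, h⟩
    · obtain ⟨l1, l2, rfl, h1, h2⟩ := ih h.2 hy
      exact ⟨v :: l1, l2, rfl, ⟨h.1, h1⟩, h2⟩

theorem isWalk_mono {E' : V → V → Prop} (hE : ∀ x y, E x y → E' x y) {s t : V} {l : List V}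
    (h : IsWalk E s t l) : IsWalk E' s t l := by
  induction l generalizing s with
  | nil => exact h
  | cons v l ih => exact ⟨hE _ _ h.1, ih h.2⟩

theorem isWalk_concat {s t v : V} {l : List V} (h : IsWalk E s t (l ++ [v])) :
    v = t ∧ ∃ u, IsWalk E s u l ∧ E u t := by
  induction l generalizing s with
  | nil =>
    obtain ⟨h1, h2⟩ := h
    simp only [IsWalk] at h2; subst h2
    exact ⟨rfl, s, rfl, h1⟩
  | cons w l ih =>
    obtain ⟨h0, u, h1, h2⟩ := ih h.2
    exact ⟨h0, u, ⟨h.1, h1⟩, h2⟩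

/-- loop removal -/
theorem isWalk_simple (g : V → V → ℕ) {s t : V} {l : List V} (h : IsWalk E s t l) :
    ∃ l', IsWalk E s t l' ∧ (s :: l').Nodup ∧ walkLen g s l' ≤ walkLen g s l := by
  induction l generalizing s with
  | nil => exact ⟨[], h, by simp, le_rfl⟩
  | cons v l ih =>
    obtain ⟨l', h1, h2, h3⟩ := ih h.2
    by_cases hs : s ∈ v :: l'
    · obtain ⟨a, b, rfl, ha, hb⟩ := isWalk_split h1 hs
      refine ⟨b, hb, ?_, ?_⟩
      · cases a using List.reverseRecOn with
        | nil =>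
          simp only [IsWalk] at ha; subst ha; simpa using h2
        | append_singleton a w _ =>
          obtain ⟨rfl, -⟩ := isWalk_concat ha
          refine List.Nodup.sublist ?_ h2
          simp only [List.append_assoc, List.singleton_append]
          exact List.Sublist.cons _ (List.sublist_append_right _ _)
      · rw [walkLen_append g ha] at h3
        simp only [walkLen]; omega
    · exact ⟨v :: l', ⟨h.1, h1⟩, List.nodup_cons.2 ⟨hs, h2⟩, by simp only [walkLen]; omega⟩

/-- induced subgraph relation -/
def rE (E : V → V → Prop) (Y : Finset V) (x y : V) : Prop := x ∈ Y ∧ y ∈ Y ∧ E x y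

theorem isWalk_rE_mem {Y : Finset V} {s t : V} {l : List V} (hs : s ∈ Y)
    (h : IsWalk (rE E Y) s t l) : ∀ x ∈ s :: l, x ∈ Y := by
  induction l generalizing s with
  | nil => simpa using hs
  | cons v l ih =>
    intro x hx
    rcases List.mem_cons.1 hx with rfl | hx
    · exact hs
    · exact ih h.1.2.1 h.2 x hx

theorem isWalk_last_mem {Y : Finset V} {s t : V} {l : List V} (hs : s ∈ Y)
    (h : IsWalk (rE E Y) s t l) : t ∈ Y := by
  induction l generalizing s with
  | nil => simp only [IsWalk] at h; subst h; exact hs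
  | cons v l ih => exact ih h.1.2.1 h.2

/-- `σ` contains as a sublist a walk from `s` to `t` of length at most `L`. -/
def Cov (E : V → V → Prop) (g : V → V → ℕ) (σ : List V) (s t : V) (L : ℝ) : Prop :=
  ∃ l, IsWalk E s t l ∧ (s :: l).Sublist σ ∧ (walkLen g s l : ℝ) ≤ L

variable {g : V → V → ℕ}

theorem Cov.mono {σ σ' : List V} {s t : V} {L L' : ℝ} (h : Cov E g σ s t L)
    (hσ : σ.Sublist σ') (hL : L ≤ L') : Cov E g σ' s t L' := by
  obtain ⟨l, h1, h2, h3⟩ := h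
  exact ⟨l, h1, h2.trans hσ, h3.trans hL⟩

theorem Cov.refl {σ : List V} {s : V} (h : s ∈ σ) {L : ℝ} (hL : 0 ≤ L) : Cov E g σ s s L :=
  ⟨[], rfl, by simpa using h, by simpa [walkLen] using hL⟩

theorem Cov.edge {σ₁ σ₂ : List V} {s u v t : V} {L₁ L₂ : ℝ} (h1 : Cov E g σ₁ s u L₁)
    (he : E u v) (h2 : Cov E g σ₂ v t L₂) : Cov E g (σ₁ ++ σ₂) s t (L₁ + g u v + L₂) := by
  obtain ⟨l1, a1, b1, c1⟩ := h1
  obtain ⟨l2, a2, b2, c2⟩ := h2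
  refine ⟨l1 ++ v :: l2, isWalk_append a1 ⟨he, a2⟩, ?_, ?_⟩
  · exact List.Sublist.append b1 b2
  · rw [walkLen_append g a1]; simp only [walkLen]; push_cast; linarith

theorem Cov.join {σ₁ σ₂ : List V} {s u t : V} {L₁ L₂ : ℝ} (h1 : Cov E g σ₁ s u L₁)
    (h2 : Cov E g σ₂ u t L₂) : Cov E g (σ₁ ++ σ₂) s t (L₁ + L₂) := by
  obtain ⟨l1, a1, b1, c1⟩ := h1
  obtain ⟨l2, a2, b2, c2⟩ := h2
  refine ⟨l1 ++ l2, isWalk_append a1 a2, ?_, ?_⟩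
  · exact List.Sublist.append b1 ((List.sublist_cons_self _ _).trans b2)
  · rw [walkLen_append g a1]; push_cast; linarith

/-- Truncated distance. -/
noncomputable def dN (E : V → V → Prop) (g : V → V → ℕ) (C : ℕ) (s t : V) : ℕ :=
  sInf {L | C ≤ L ∨ ∃ l, IsWalk E s t l ∧ walkLen g s l = L}

variable {C : ℕ}

theorem dN_mem (s t : V) : C ≤ dN E g C s t ∨ ∃ l, IsWalk E s t l ∧ walkLen g s l = dN E g C s t :=
  Nat.sInf_mem (s := {L | C ≤ L ∨ ∃ l, IsWalk E s t l ∧ walkLen g s l = L}) ⟨C, Or.inl le_rfl⟩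

theorem dN_le {s t : V} {l : List V} (h : IsWalk E s t l) : dN E g C s t ≤ walkLen g s l :=
  Nat.sInf_le (Or.inr ⟨l, h, rfl⟩)

theorem dN_le_C (s t : V) : dN E g C s t ≤ C := Nat.sInf_le (Or.inl le_rfl)

theorem dN_spec {s t : V} (h : dN E g C s t < C) :
    ∃ l, IsWalk E s t l ∧ walkLen g s l = dN E g C s t := by
  rcases dN_mem (E := E) (g := g) (C := C) s t with h' | h'
  · omega
  · exact h'

theorem dN_self (s : V) : dN E g C s s = 0 := by
  have := dN_le (E := E) (g := g) (C := C) (s := s) (t := s) (l := []) rfl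
  simpa [walkLen] using this

theorem dN_edge {s t : V} (h : E s t) : dN E g C s t ≤ g s t := by
  have := dN_le (E := E) (g := g) (C := C) (s := s) (t := t) (l := [t]) ⟨h, rfl⟩
  simpa [walkLen] using this

theorem dN_tri (s u t : V) : dN E g C s t ≤ dN E g C s u + dN E g C u t := by
  have h0 := dN_le_C (E := E) (g := g) (C := C) s t
  rcases dN_mem (E := E) (g := g) (C := C) s u with h1 | ⟨l1, h1, e1⟩
  · omega
  rcases dN_mem (E := E) (g := g) (C := C) u t with h2 | ⟨l2, h2, e2⟩
  · omega
  have := dN_le (g := g) (C := C) (isWalk_append h1 h2)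
  rw [walkLen_append g h1] at this
  omega

/-- list of the vertices of `Y` by decreasing key -/
noncomputable def decL (Y : Finset V) (δ : V → ℕ) : ℕ → List V
  | 0 => (Y.filter (fun v => δ v = 0)).toList
  | n + 1 => (Y.filter (fun v => δ v = n + 1)).toList ++ decL Y δ n

/-- list of the vertices of `Y` by increasing key -/
noncomputable def incL (Y : Finset V) (δ : V → ℕ) : ℕ → List V
  | 0 => (Y.filter (fun v => δ v = 0)).toList
  | n + 1 => incL Y δ n ++ (Y.filter (fun v => δ v = n + 1)).toList

theorem mem_decL {Y : Finset V} {δ : V → ℕ} {n : ℕ} {v : V} :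
    v ∈ decL Y δ n ↔ v ∈ Y ∧ δ v ≤ n := by
  induction n with
  | zero => simp [decL]
  | succ n ih =>
    simp only [decL, List.mem_append, Finset.mem_toList, Finset.mem_filter, ih]
    constructor
    · rintro (⟨h, h'⟩ | ⟨h, h'⟩) <;> exact ⟨h, by omega⟩
    · rintro ⟨h, h'⟩
      rcases Nat.lt_or_ge n (δ v) with h2 | h2
      · exact Or.inl ⟨h, by omega⟩
      · exact Or.inr ⟨h, h2⟩

theorem mem_incL {Y : Finset V} {δ : V → ℕ} {n : ℕ} {v : V} :
    v ∈ incL Y δ n ↔ v ∈ Y ∧ δ v ≤ n := by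
  induction n with
  | zero => simp [incL]
  | succ n ih =>
    simp only [incL, List.mem_append, Finset.mem_toList, Finset.mem_filter, ih]
    constructor
    · rintro (⟨h, h'⟩ | ⟨h, h'⟩) <;> exact ⟨h, by omega⟩
    · rintro ⟨h, h'⟩
      rcases Nat.lt_or_ge n (δ v) with h2 | h2
      · exact Or.inr ⟨h, by omega⟩
      · exact Or.inl ⟨h, h2⟩

theorem nodup_decL {Y : Finset V} {δ : V → ℕ} (n : ℕ) : (decL Y δ n).Nodup := by
  induction n with
  | zero => exact Finset.nodup_toList _
  | succ n ih =>
    refine List.Nodup.append (Finset.nodup_toList _) ih ?_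
    intro v h1 h2
    simp only [Finset.mem_toList, Finset.mem_filter, mem_decL] at h1 h2
    omega

theorem nodup_incL {Y : Finset V} {δ : V → ℕ} (n : ℕ) : (incL Y δ n).Nodup := by
  induction n with
  | zero => exact Finset.nodup_toList _
  | succ n ih =>
    refine List.Nodup.append ih (Finset.nodup_toList _) ?_
    intro v h1 h2
    simp only [Finset.mem_toList, Finset.mem_filter, mem_incL] at h1 h2
    omega

theorem decL_mono {Y : Finset V} {δ : V → ℕ} {m n : ℕ} (h : m ≤ n) :
    (decL Y δ m).Sublist (decL Y δ n) := by
  induction n, h using Nat.le_induction with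
  | base => exact List.Sublist.refl _
  | succ n _ ih => exact ih.trans (List.sublist_append_right _ _)

theorem incL_mono {Y : Finset V} {δ : V → ℕ} {m n : ℕ} (h : m ≤ n) :
    (incL Y δ m).Sublist (incL Y δ n) := by
  induction n, h using Nat.le_induction with
  | base => exact List.Sublist.refl _
  | succ n _ ih => exact ih.trans (List.sublist_append_left _ _)

theorem cov_decL {Y : Finset V} (hpos : ∀ x y, E x y → 0 < g x y) (r : V) (n : ℕ) :
    ∀ s ∈ Y, dN (rE E Y) g C s r = n → n < C →
      Cov E g (decL Y (fun v => dN (rE E Y) g C v r) n) s r n := by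
  induction n using Nat.strong_induction_on with
  | _ n ih =>
  intro s hs hd hC
  obtain ⟨l, hl, hlen⟩ := dN_spec (E := rE E Y) (g := g) (C := C) (s := s) (t := r) (by omega)
  cases l with
  | nil =>
    simp only [IsWalk] at hl; subst hl
    exact Cov.refl (mem_decL (δ := fun v => dN (rE E Y) g C v s).2 ⟨hs, hd.le⟩)
      (Nat.cast_nonneg _)
  | cons v l =>
    have h1 := dN_le (g := g) (C := C) hl.2
    have h2 := hpos _ _ hl.1.2.2
    simp only [walkLen] at hlen
    have h3 := ih (dN (rE E Y) g C v r) (by omega) v hl.1.2.1 rfl (by omega)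
    obtain ⟨k, rfl⟩ : ∃ k, n = k + 1 := ⟨n - 1, by omega⟩
    have h4 := h3.mono (decL_mono (n := k) (by omega)) le_rfl
    have h5 : Cov E g (Y.filter (fun v => dN (rE E Y) g C v r = k + 1)).toList s s 0 :=
      Cov.refl (by simp [hs, hd]) le_rfl
    refine (h5.edge hl.1.2.2 h4).mono (List.Sublist.refl _) ?_
    have : g s v + dN (rE E Y) g C v r ≤ k + 1 := by omega
    have : (g s v + dN (rE E Y) g C v r : ℝ) ≤ (k + 1 : ℕ) := by exact_mod_cast this
    linarith

theorem cov_incL {Y : Finset V} (hpos : ∀ x y, E x y → 0 < g x y) (r : V) (hr : r ∈ Y) (n : ℕ) :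
    ∀ t, dN (rE E Y) g C r t = n → n < C →
      Cov E g (incL Y (fun v => dN (rE E Y) g C r v) n) r t n := by
  induction n using Nat.strong_induction_on with
  | _ n ih =>
  intro t hd hC
  obtain ⟨l, hl, hlen⟩ := dN_spec (E := rE E Y) (g := g) (C := C) (s := r) (t := t) (by omega)
  cases l using List.reverseRecOn with
  | nil =>
    simp only [IsWalk] at hl; subst hl
    exact Cov.refl (mem_incL.2 ⟨hr, hd.le⟩) (Nat.cast_nonneg _)
  | append_singleton l w _ =>
    obtain ⟨rfl, u, h0, h0'⟩ := isWalk_concat hl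
    rw [walkLen_append g h0] at hlen
    have h1 := dN_le (g := g) (C := C) h0
    have h2 := hpos _ _ h0'.2.2
    simp only [walkLen] at hlen
    have h3 := ih (dN (rE E Y) g C r u) (by omega) u rfl (by omega)
    obtain ⟨k, rfl⟩ : ∃ k, n = k + 1 := ⟨n - 1, by omega⟩
    have h4 := h3.mono (incL_mono (n := k) (by omega)) le_rfl
    have h5 : Cov E g (Y.filter (fun v => dN (rE E Y) g C r v = k + 1)).toList w w 0 :=
      Cov.refl (by simp [h0'.2.1, hd]) le_rfl
    refine (h4.edge h0'.2.2 h5).mono (List.Sublist.refl _) ?_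
    have : g u w + dN (rE E Y) g C r u ≤ k + 1 := by omega
    have : (g u w + dN (rE E Y) g C r u : ℝ) ≤ (k + 1 : ℕ) := by exact_mod_cast this
    linarith

theorem landmark {Y : Finset V} (hpos : ∀ x y, E x y → 0 < g x y) (C : ℕ) (r : V) (hr : r ∈ Y) :
    ∃ σ : List V, (∀ v ∈ σ, v ∈ Y) ∧ (∀ v, σ.count v ≤ 2) ∧
      ∀ s ∈ Y, ∀ t, dN (rE E Y) g C s r < C → dN (rE E Y) g C r t < C →
        Cov E g σ s t ((dN (rE E Y) g C s r : ℝ) + dN (rE E Y) g C r t) := by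
  refine ⟨decL Y (fun v => dN (rE E Y) g C v r) C ++ incL Y (fun v => dN (rE E Y) g C r v) C,
    ?_, ?_, ?_⟩
  · intro v hv
    rcases List.mem_append.1 hv with h | h
    · exact (mem_decL.1 h).1
    · exact (mem_incL.1 h).1
  · intro v
    rw [List.count_append]
    have h1 := List.nodup_iff_count_le_one.1 (nodup_decL (Y := Y)
      (δ := fun v => dN (rE E Y) g C v r) C) v
    have h2 := List.nodup_iff_count_le_one.1 (nodup_incL (Y := Y)
      (δ := fun v => dN (rE E Y) g C r v) C) v
    omega
  · intro s hs t h1 h2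
    exact ((cov_decL hpos r _ s hs rfl h1).mono (decL_mono h1.le) le_rfl).join
      ((cov_incL hpos r hr _ t rfl h2).mono (incL_mono h2.le) le_rfl)

end Walks

section Balls
variable {V : Type*}

theorem ball_lemma (Y : Finset V) (w : V → V → ℝ) (g : V → V → ℕ) (μ : V → ℝ) (δ : V → ℕ)
    (a T : ℕ) (σ : ℝ) (u : V)
    (hw : ∀ x y, 0 ≤ w x y) (hσ : 0 < σ)
    (hμ : ∀ x ∈ Y, σ + ∑ y ∈ Y, w x y * g x y ≤ μ x)
    (hδ : ∀ x ∈ Y, ∀ y ∈ Y, w x y ≠ 0 → δ y ≤ δ x + g x y)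
    (hu : u ∈ Y) (hu0 : δ u = 0) (ha : 0 < a)
    (hT : ∑ x ∈ Y, μ x < 2 ^ T * σ) :
    ∃ r, r < T * a ∧
      a * ∑ x ∈ Y.filter (fun y => δ y ≤ r), ∑ y ∈ Y.filter (fun y => ¬ δ y ≤ r), w x y
        ≤ 2 * ∑ x ∈ Y.filter (fun y => δ y ≤ r), μ x := by
  have hμ0 : ∀ x ∈ Y, 0 ≤ μ x := fun x hx => by
    have := hμ x hx
    have h2 : 0 ≤ ∑ y ∈ Y, w x y * g x y :=
      Finset.sum_nonneg fun y _ => mul_nonneg (hw x y) (Nat.cast_nonneg _)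
    linarith
  have hstep : ∃ i, i < T ∧ ∑ x ∈ Y.filter (fun y => δ y ≤ (i + 1) * a), μ x
      ≤ 2 * ∑ x ∈ Y.filter (fun y => δ y ≤ i * a), μ x := by
    by_contra! hcon
    have key : ∀ i, i ≤ T → 2 ^ i * σ ≤ ∑ x ∈ Y.filter (fun y => δ y ≤ i * a), μ x := by
      intro i
      induction i with
      | zero =>
        intro _
        have h1 : μ u ≤ ∑ x ∈ Y.filter (fun y => δ y ≤ 0 * a), μ x :=
          Finset.single_le_sum (f := μ) (fun x hx => hμ0 x (Finset.mem_filter.1 hx).1)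
            (Finset.mem_filter.2 ⟨hu, by omega⟩)
        have h2 := hμ u hu
        have h3 : 0 ≤ ∑ y ∈ Y, w u y * g u y :=
          Finset.sum_nonneg fun y _ => mul_nonneg (hw u y) (Nat.cast_nonneg _)
        simp only [pow_zero, one_mul]
        linarith
      | succ i ih =>
        intro hi
        have h1 := ih (by omega)
        have h2 := hcon i (by omega)
        rw [pow_succ]; linarith
    have h1 := key T le_rfl
    have h2 : ∑ x ∈ Y.filter (fun y => δ y ≤ T * a), μ x ≤ ∑ x ∈ Y, μ x :=
      Finset.sum_le_sum_of_subset_of_nonneg (Finset.filter_subset _ _) fun x hx _ => hμ0 x hx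
    linarith
  obtain ⟨i, hiT, hi⟩ := hstep
  set cut : ℕ → ℝ := fun r =>
    ∑ x ∈ Y.filter (fun y => δ y ≤ r), ∑ y ∈ Y.filter (fun y => ¬ δ y ≤ r), w x y with hcut
  set S := Finset.Ico (i * a) ((i + 1) * a) with hS
  have hScard : S.card = a := by simp [hS, add_mul]
  have hsum : ∑ r ∈ S, cut r ≤ ∑ x ∈ Y.filter (fun y => δ y ≤ (i + 1) * a), μ x := by
    have e1 : ∀ r, cut r = ∑ x ∈ Y, ∑ y ∈ Y, if δ x ≤ r ∧ ¬ δ y ≤ r then w x y else 0 := by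
      intro r
      simp only [hcut, Finset.sum_filter]
      refine Finset.sum_congr rfl fun x _ => ?_
      by_cases hx : δ x ≤ r <;> simp [hx]
    simp only [e1]
    rw [Finset.sum_comm]
    rw [Finset.sum_filter]
    refine Finset.sum_le_sum fun x hx => ?_
    rw [Finset.sum_comm]
    split_ifs with hxi
    · refine le_trans ?_ ((le_add_of_nonneg_left hσ.le).trans (hμ x hx))
      refine Finset.sum_le_sum fun y hy => ?_
      by_cases hw0 : w x y = 0
      · simp [hw0]
      rw [← Finset.sum_filter, Finset.sum_const, nsmul_eq_mul, mul_comm]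
      refine mul_le_mul_of_nonneg_left ?_ (hw x y)
      have hd := hδ x hx y hy hw0
      have : (S.filter (fun r => δ x ≤ r ∧ ¬ δ y ≤ r)).card ≤ g x y := by
        calc _ ≤ (Finset.Ico (δ x) (δ x + g x y)).card := by
              refine Finset.card_le_card fun r hr => ?_
              simp only [Finset.mem_filter, Finset.mem_Ico] at hr ⊢
              omega
          _ = g x y := by simp
      exact_mod_cast this
    · refine le_of_eq (Finset.sum_eq_zero fun y _ => Finset.sum_eq_zero fun r hr => ?_)
      simp only [hS, Finset.mem_Ico] at hr
      rw [if_neg]; omega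
  have hSne : S.Nonempty := Finset.card_pos.1 (by omega)
  obtain ⟨r, hr, hrle⟩ := Finset.exists_le_of_sum_le (s := S) (f := cut)
    (g := fun _ => (∑ x ∈ Y.filter (fun y => δ y ≤ (i + 1) * a), μ x) / a) hSne (by
      rw [Finset.sum_const, hScard, nsmul_eq_mul, mul_div_cancel₀]
      · exact hsum
      · positivity)
  simp only [hS, Finset.mem_Ico] at hr
  refine ⟨r, ?_, ?_⟩
  · calc r < (i + 1) * a := hr.2
      _ ≤ T * a := Nat.mul_le_mul_right _ hiT
  · have ha' : (0 : ℝ) < a := by exact_mod_cast ha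
    have h1 : a * cut r ≤ ∑ x ∈ Y.filter (fun y => δ y ≤ (i + 1) * a), μ x := by
      rw [le_div_iff₀ ha'] at hrle; linarith
    have h2 : ∑ x ∈ Y.filter (fun y => δ y ≤ i * a), μ x
        ≤ ∑ x ∈ Y.filter (fun y => δ y ≤ r), μ x := by
      refine Finset.sum_le_sum_of_subset_of_nonneg ?_
        fun x hx _ => hμ0 x (Finset.mem_filter.1 hx).1
      intro x hx
      simp only [Finset.mem_filter] at hx ⊢
      exact ⟨hx.1, hx.2.trans hr.1⟩
    show a * cut r ≤ _
    linarith

/-- total weight of backward edges -/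
noncomputable def backW (w : V → V → ℝ) (f : V → ℕ) (Y : Finset V) : ℝ :=
  ∑ x ∈ Y, ∑ y ∈ Y, if f y < f x then w x y else 0

/-- ordered partition given by `f` into small or low diameter clusters. -/
def IsDec (d : V → V → ℕ) (m D : ℕ) (f : V → ℕ) (R : ℕ) (Y : Finset V) : Prop :=
  (∀ y ∈ Y, f y < R) ∧ ∀ i, (Y.filter (fun y => f y = i)).card ≤ m ∨
    ∀ x ∈ Y, ∀ y ∈ Y, f x = i → f y = i → d x y ≤ D

theorem dec_combine (w : V → V → ℝ) (d : V → V → ℕ) (m D : ℕ) {P Q Y : Finset V} (hPQ : Disjoint P Q)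
    (hY : P ∪ Q = Y) {f₁ f₂ : V → ℕ} {R₁ R₂ : ℕ} (h₁ : IsDec d m D f₁ R₁ P)
    (h₂ : IsDec d m D f₂ R₂ Q) :
    ∃ f R, IsDec d m D f R Y ∧
      backW w f Y = backW w f₁ P + backW w f₂ Q + ∑ x ∈ Q, ∑ y ∈ P, w x y := by
  subst hY
  set f : V → ℕ := fun x => if x ∈ P then f₁ x else R₁ + f₂ x with hf
  have fP : ∀ x ∈ P, f x = f₁ x := fun x hx => by simp [hf, hx]
  have fQ : ∀ x ∈ Q, f x = R₁ + f₂ x := fun x hx => by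
    simp [hf, Finset.disjoint_right.1 hPQ hx]
  refine ⟨f, R₁ + R₂, ⟨?_, ?_⟩, ?_⟩
  · intro y hy
    rcases Finset.mem_union.1 hy with h | h
    · rw [fP y h]; have := h₁.1 y h; omega
    · rw [fQ y h]; have := h₂.1 y h; omega
  · intro i
    by_cases hi : i < R₁
    · have e : (P ∪ Q).filter (fun y => f y = i) = P.filter (fun y => f₁ y = i) := by
        ext x
        simp only [Finset.mem_filter, Finset.mem_union]
        constructor
        · rintro ⟨h | h, e⟩
          · exact ⟨h, (fP x h).symm.trans e⟩
          · rw [fQ x h] at e; omega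
        · rintro ⟨h, e⟩
          exact ⟨Or.inl h, (fP x h).trans e⟩
      have key : ∀ x, x ∈ P ∪ Q ∧ f x = i → x ∈ P ∧ f₁ x = i := fun x hx => by
        simpa using (e ▸ Finset.mem_filter.2 hx : x ∈ P.filter (fun y => f₁ y = i))
      rcases h₁.2 i with h | h
      · left; rw [e]; exact h
      · right
        intro x hx y hy ex ey
        obtain ⟨a1, a2⟩ := key x ⟨hx, ex⟩
        obtain ⟨b1, b2⟩ := key y ⟨hy, ey⟩
        exact h x a1 y b1 a2 b2
    · have e : (P ∪ Q).filter (fun y => f y = i) = Q.filter (fun y => f₂ y = i - R₁) := by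
        ext x
        simp only [Finset.mem_filter, Finset.mem_union]
        constructor
        · rintro ⟨h | h, e⟩
          · rw [fP x h] at e; have := h₁.1 x h; omega
          · rw [fQ x h] at e; exact ⟨h, by omega⟩
        · rintro ⟨h, e⟩
          exact ⟨Or.inr h, by rw [fQ x h]; omega⟩
      have key : ∀ x, x ∈ P ∪ Q ∧ f x = i → x ∈ Q ∧ f₂ x = i - R₁ := fun x hx => by
        simpa using (e ▸ Finset.mem_filter.2 hx : x ∈ Q.filter (fun y => f₂ y = i - R₁))
      rcases h₂.2 (i - R₁) with h | h
      · left; rw [e]; exact h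
      · right
        intro x hx y hy ex ey
        obtain ⟨a1, a2⟩ := key x ⟨hx, ex⟩
        obtain ⟨b1, b2⟩ := key y ⟨hy, ey⟩
        exact h x a1 y b1 a2 b2
  · unfold backW
    rw [Finset.sum_union hPQ]
    have e1 : ∑ x ∈ P, ∑ y ∈ P ∪ Q, (if f y < f x then w x y else 0)
        = ∑ x ∈ P, ∑ y ∈ P, (if f₁ y < f₁ x then w x y else 0) := by
      refine Finset.sum_congr rfl fun x hx => ?_
      rw [Finset.sum_union hPQ]
      have : ∑ y ∈ Q, (if f y < f x then w x y else 0) = 0 := by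
        refine Finset.sum_eq_zero fun y hy => if_neg ?_
        rw [fP x hx, fQ y hy]; have := h₁.1 x hx; omega
      rw [this, add_zero]
      refine Finset.sum_congr rfl fun y hy => ?_
      rw [fP x hx, fP y hy]
    have e2 : ∑ x ∈ Q, ∑ y ∈ P ∪ Q, (if f y < f x then w x y else 0)
        = ∑ x ∈ Q, ∑ y ∈ P, w x y + ∑ x ∈ Q, ∑ y ∈ Q, (if f₂ y < f₂ x then w x y else 0) := by
      rw [← Finset.sum_add_distrib]
      refine Finset.sum_congr rfl fun x hx => ?_
      rw [Finset.sum_union hPQ]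
      congr 1
      · refine Finset.sum_congr rfl fun y hy => if_pos ?_
        rw [fQ x hx, fP y hy]; have := h₁.1 y hy; omega
      · refine Finset.sum_congr rfl fun y hy => ?_
        rw [fQ x hx, fQ y hy]; simp
    rw [e1, e2]; ring

theorem exists_dec (w : V → V → ℝ) (g : V → V → ℕ) (d : V → V → ℕ) (μ : V → ℝ) (a T m : ℕ) (σ : ℝ)
    (Y : Finset V)
    (hw : ∀ x y, 0 ≤ w x y) (hσ : 0 < σ) (ha : 0 < a)
    (hμ : ∀ x ∈ Y, σ + ∑ y ∈ Y, w x y * g x y + ∑ y ∈ Y, w y x * g y x ≤ μ x)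
    (hd0 : ∀ x, d x x = 0) (hdt : ∀ x y z, d x z ≤ d x y + d y z)
    (hde : ∀ x ∈ Y, ∀ y ∈ Y, w x y ≠ 0 → d x y ≤ g x y)
    (hT : ∑ x ∈ Y, μ x < 2 ^ T * σ) :
    ∀ n, ∀ Y' ⊆ Y, Y'.card ≤ n → ∃ f R, IsDec d m (2 * T * a) f R Y' ∧
      a * backW w f Y' ≤ 2 * Nat.log 2 Y'.card * ∑ x ∈ Y', μ x := by
  have s1 : ∀ x (Z : Finset V), 0 ≤ ∑ y ∈ Z, w x y * g x y := fun x Z =>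
    Finset.sum_nonneg fun y _ => mul_nonneg (hw x y) (Nat.cast_nonneg _)
  have s2 : ∀ x (Z : Finset V), 0 ≤ ∑ y ∈ Z, w y x * g y x := fun x Z =>
    Finset.sum_nonneg fun y _ => mul_nonneg (hw y x) (Nat.cast_nonneg _)
  have hμ0 : ∀ x ∈ Y, 0 ≤ μ x := fun x hx => by
    have := hμ x hx
    have := s1 x Y
    have := s2 x Y
    linarith
  intro n
  induction n with
  | zero =>
    intro Y' _ hc
    have : Y' = ∅ := Finset.card_eq_zero.1 (by omega)
    subst this
    exact ⟨fun _ => 0, 0, ⟨by simp, fun i => Or.inl (by simp)⟩, by simp [backW]⟩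
  | succ n ih =>
    intro Y' hY' hc
    by_cases hdone : Y'.card ≤ m ∨ ∀ x ∈ Y', ∀ y ∈ Y', d x y ≤ 2 * T * a
    · refine ⟨fun _ => 0, 1, ⟨by simp, fun i => ?_⟩, ?_⟩
      · rcases hdone with h | h
        · exact Or.inl ((Finset.card_filter_le _ _).trans h)
        · exact Or.inr fun x hx y hy _ _ => h x hx y hy
      · simp only [backW, lt_irrefl, if_false, Finset.sum_const_zero, mul_zero]
        exact mul_nonneg (by positivity) (Finset.sum_nonneg fun x hx => hμ0 x (hY' hx))
    push Not at hdone
    obtain ⟨-, u, hu, v, hv, huv⟩ := hdone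
    have hTY' : ∑ x ∈ Y', μ x < 2 ^ T * σ := lt_of_le_of_lt
      (Finset.sum_le_sum_of_subset_of_nonneg hY' fun x hx _ => hμ0 x hx) hT
    -- out ball of u
    obtain ⟨r₁, hr₁, hc₁⟩ := ball_lemma Y' w g μ (fun y => d u y) a T σ u hw hσ
      (fun x hx => by
        have h1 := hμ x (hY' hx)
        have h2 : ∑ y ∈ Y', w x y * g x y ≤ ∑ y ∈ Y, w x y * g x y :=
          Finset.sum_le_sum_of_subset_of_nonneg hY'
            fun y _ _ => mul_nonneg (hw x y) (Nat.cast_nonneg _)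
        have := s2 x Y
        linarith)
      (fun x hx y hy hxy => (hdt u x y).trans
        (Nat.add_le_add_left (hde x (hY' hx) y (hY' hy) hxy) _)) hu (hd0 u) ha hTY'
    obtain ⟨r₂, hr₂, hc₂⟩ := ball_lemma Y' (fun x y => w y x) (fun x y => g y x) μ
      (fun y => d y v) a T σ v (fun x y => hw y x) hσ
      (fun x hx => by
        have h1 := hμ x (hY' hx)
        have h2 : ∑ y ∈ Y', w y x * g y x ≤ ∑ y ∈ Y, w y x * g y x :=
          Finset.sum_le_sum_of_subset_of_nonneg hY'
            fun y _ _ => mul_nonneg (hw y x) (Nat.cast_nonneg _)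
        have := s1 x Y
        linarith)
      (fun x hx y hy hxy => by
        have h1 := hdt y x v
        have h2 := hde y (hY' hy) x (hY' hx) hxy
        show d y v ≤ d x v + g y x
        omega) hv (hd0 v) ha hTY'
    -- common final computation
    have fin : ∀ (B : Finset V), B ⊆ Y' → B.Nonempty → 2 * B.card ≤ Y'.card → ∀ bB bQ ct : ℝ,
        a * bB ≤ 2 * Nat.log 2 B.card * ∑ x ∈ B, μ x →
        a * bQ ≤ 2 * Nat.log 2 (Y' \ B).card * ∑ x ∈ Y' \ B, μ x →
        a * ct ≤ 2 * ∑ x ∈ B, μ x →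
        a * (bB + bQ + ct) ≤ 2 * Nat.log 2 Y'.card * ∑ x ∈ Y', μ x := by
      intro B hB hBne hhalf bB bQ ct i1 i2 i3
      have hBpos := Finset.card_pos.2 hBne
      have l1 : Nat.log 2 B.card + 1 ≤ Nat.log 2 Y'.card := by
        rw [← Nat.log_mul_base (by norm_num) (by omega)]
        exact Nat.log_mono_right (by omega)
      have l2 : Nat.log 2 (Y' \ B).card ≤ Nat.log 2 Y'.card :=
        Nat.log_mono_right (Finset.card_le_card Finset.sdiff_subset)
      have l1' : (Nat.log 2 B.card : ℝ) + 1 ≤ Nat.log 2 Y'.card := by exact_mod_cast l1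
      have l2' : (Nat.log 2 (Y' \ B).card : ℝ) ≤ Nat.log 2 Y'.card := by exact_mod_cast l2
      have m1 : 0 ≤ ∑ x ∈ B, μ x := Finset.sum_nonneg fun x hx => hμ0 x (hY' (hB hx))
      have m2 : 0 ≤ ∑ x ∈ Y' \ B, μ x :=
        Finset.sum_nonneg fun x hx => hμ0 x (hY' (Finset.sdiff_subset hx))
      have m3 : ∑ x ∈ Y', μ x = ∑ x ∈ Y' \ B, μ x + ∑ x ∈ B, μ x :=
        (Finset.sum_sdiff hB).symm
      rw [m3]
      have k1 := mul_le_mul_of_nonneg_right l1' m1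
      have k2 := mul_le_mul_of_nonneg_right l2' m2
      nlinarith
    set B₁ := Y'.filter (fun y => d u y ≤ r₁) with hB₁
    set B₂ := Y'.filter (fun y => d y v ≤ r₂) with hB₂
    have hdis : Disjoint B₁ B₂ := by
      rw [Finset.disjoint_left]
      intro x h1 h2
      simp only [hB₁, hB₂, Finset.mem_filter] at h1 h2
      have := hdt u x v
      have : 2 * T * a = T * a + T * a := by ring
      omega
    have hcard : B₁.card + B₂.card ≤ Y'.card := by
      rw [← Finset.card_union_of_disjoint hdis]
      exact Finset.card_le_card (Finset.union_subset (Finset.filter_subset _ _)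
        (Finset.filter_subset _ _))
    have ne₁ : B₁.Nonempty := ⟨u, by simp [hB₁, hu, hd0]⟩
    have ne₂ : B₂.Nonempty := ⟨v, by simp [hB₂, hv, hd0]⟩
    have p₁ := Finset.card_pos.2 ne₁
    have p₂ := Finset.card_pos.2 ne₂
    rcases le_total B₁.card B₂.card with hle | hle
    · have hsub : B₁ ⊆ Y' := Finset.filter_subset _ _
      have hcs := Finset.card_sdiff_add_card_eq_card hsub
      obtain ⟨f₁, R₁, d₁, b₁⟩ := ih B₁ (hsub.trans hY') (by omega)
      obtain ⟨f₂, R₂, d₂, b₂⟩ := ih (Y' \ B₁) (Finset.sdiff_subset.trans hY') (by omega)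
      obtain ⟨f, R, hdec, hb⟩ := dec_combine w d m (2 * T * a) (Y := Y')
        Finset.sdiff_disjoint (Finset.sdiff_union_of_subset hsub) d₂ d₁
      refine ⟨f, R, hdec, ?_⟩
      rw [hb, add_comm (backW w f₂ _)]
      refine fin B₁ hsub ne₁ (by omega) _ _ _ b₁ b₂ ?_
      rw [Finset.filter_not, ← hB₁] at hc₁
      exact hc₁
    · have hsub : B₂ ⊆ Y' := Finset.filter_subset _ _
      have hcs := Finset.card_sdiff_add_card_eq_card hsub
      obtain ⟨f₁, R₁, d₁, b₁⟩ := ih B₂ (hsub.trans hY') (by omega)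
      obtain ⟨f₂, R₂, d₂, b₂⟩ := ih (Y' \ B₂) (Finset.sdiff_subset.trans hY') (by omega)
      obtain ⟨f, R, hdec, hb⟩ := dec_combine w d m (2 * T * a) (Y := Y')
        Finset.disjoint_sdiff (Finset.union_sdiff_of_subset hsub) d₁ d₂
      refine ⟨f, R, hdec, ?_⟩
      rw [hb]
      refine fin B₂ hsub ne₂ (by omega) _ _ _ b₁ b₂ ?_
      rw [Finset.filter_not, ← hB₂] at hc₂
      rw [Finset.sum_comm]
      exact hc₂

end Balls

section Family
variable {V : Type*} {E : V → V → Prop}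

/-- number of occurrences of the edge `(x,y)` -/
noncomputable def cntE (x y : V) (s : V) (l : List V) : ℕ :=
  walkLen (fun a b => if a = x ∧ b = y then 1 else 0) s l

theorem walkLen_eq_sum (h : V → V → ℕ) {Y : Finset V} {s t : V} {l : List V} (hs : s ∈ Y)
    (hl : IsWalk (rE E Y) s t l) :
    walkLen h s l = ∑ x ∈ Y, ∑ y ∈ Y, cntE x y s l * h x y := by
  induction l generalizing s with
  | nil => simp [walkLen, cntE]
  | cons v l ih =>
    have hv := hl.1.2.1
    have e := ih hv hl.2
    simp only [cntE, walkLen] at e ⊢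
    simp only [add_mul, Finset.sum_add_distrib]
    rw [← e]
    congr 1
    rw [Finset.sum_eq_single s, Finset.sum_eq_single v]
    · simp
    · intro y _ hy; simp [Ne.symm hy]
    · intro h; exact absurd hv h
    · intro x _ hx; simp [Ne.symm hx]
    · intro h; exact absurd hs h

theorem cntE_ne {Y : Finset V} {s t x y : V} {l : List V}
    (hl : IsWalk (rE E Y) s t l) (h : cntE x y s l ≠ 0) : rE E Y x y := by
  induction l generalizing s with
  | nil => simp [cntE, walkLen] at h
  | cons v l ih =>
    by_cases hc : cntE x y v l = 0
    · by_cases he : s = x ∧ v = y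
      · obtain ⟨rfl, rfl⟩ := he; exact hl.1
      · exact absurd (by simp only [cntE] at hc; simp [cntE, walkLen, hc, he]) h
    · exact ih hl.2 hc

/-- indicator of backward edges -/
noncomputable def backI (f : V → ℕ) (x y : V) : ℕ := if f y < f x then 1 else 0

theorem half_lemma (g : V → V → ℕ) (Y : Finset V) (Fam : Finset (V × V)) (pth : V × V → List V)
    (A T j C m lam : ℕ) (hA : 0 < A) (hlam : 0 < lam) (hYl : Nat.log 2 Y.card ≤ lam)
    (hT : 3 * Y.card < 2 ^ T)
    (hs : ∀ p ∈ Fam, p.1 ∈ Y) (hp : ∀ p ∈ Fam, IsWalk (rE E Y) p.1 p.2 (pth p))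
    (hlen : ∀ p ∈ Fam, walkLen g p.1 (pth p) ≤ A * 2 ^ (j + 1))
    (hlen0 : ∀ p ∈ Fam, 0 < walkLen g p.1 (pth p)) (hne : Fam.Nonempty) :
    ∃ f R, IsDec (dN (rE E Y) g C) m (2 * T * 2 ^ j) f R Y ∧
      2 * (Fam.filter (fun p => ¬ walkLen (backI f) p.1 (pth p) ≤ 24 * lam * A)).card
        ≤ Fam.card := by
  set w : V → V → ℝ := fun x y => ∑ p ∈ Fam, (cntE x y p.1 (pth p) : ℝ) with hwdef
  have hw : ∀ x y, 0 ≤ w x y := fun x y => Finset.sum_nonneg fun p _ => Nat.cast_nonneg _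
  have lin : ∀ h : V → V → ℕ, ∑ x ∈ Y, ∑ y ∈ Y, w x y * h x y
      = ∑ p ∈ Fam, (walkLen h p.1 (pth p) : ℝ) := by
    intro h
    have e : ∀ p ∈ Fam, (walkLen h p.1 (pth p) : ℝ)
        = ∑ x ∈ Y, ∑ y ∈ Y, (cntE x y p.1 (pth p) : ℝ) * h x y := by
      intro p hpF
      rw [walkLen_eq_sum h (hs p hpF) (hp p hpF)]
      push_cast; rfl
    rw [Finset.sum_congr rfl e]
    symm
    rw [Finset.sum_comm]
    refine Finset.sum_congr rfl fun x _ => ?_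
    rw [Finset.sum_comm]
    refine Finset.sum_congr rfl fun y _ => ?_
    simp only [hwdef, Finset.sum_mul]
  set vol : ℝ := ∑ p ∈ Fam, (walkLen g p.1 (pth p) : ℝ) with hvol
  have hvol0 : 0 < vol := Finset.sum_pos (fun p h => by exact_mod_cast hlen0 p h) hne
  have hvolle : vol ≤ Fam.card * (A * 2 ^ (j + 1)) := by
    rw [← nsmul_eq_mul]
    refine Finset.sum_le_card_nsmul Fam (fun p => (walkLen g p.1 (pth p) : ℝ)) _ fun p h => ?_
    exact_mod_cast hlen p h
  have hYpos : (0 : ℝ) < Y.card := by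
    obtain ⟨p, h⟩ := hne
    exact_mod_cast Finset.card_pos.2 ⟨_, hs p h⟩
  set μ : V → ℝ := fun x => vol / Y.card + ∑ y ∈ Y, w x y * g x y + ∑ y ∈ Y, w y x * g y x with hμ
  have hμsum : ∑ x ∈ Y, μ x = 3 * vol := by
    simp only [hμ, Finset.sum_add_distrib]
    rw [lin g, Finset.sum_comm (f := fun x y => w y x * (g y x : ℝ)), lin g, Finset.sum_const,
      nsmul_eq_mul, mul_div_cancel₀ _ hYpos.ne']
    ring
  obtain ⟨f, R, hdec, hb⟩ := exists_dec w g (dN (rE E Y) g C) μ (2 ^ j) T m (vol / Y.card) Y hw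
    (by positivity) (by positivity) (fun x _ => le_rfl) (fun x => dN_self x)
    (fun x y z => dN_tri x y z)
    (fun x _ y _ hxy => by
      obtain ⟨p, hpF, hpn⟩ := Finset.exists_ne_zero_of_sum_ne_zero
        (show ∑ p ∈ Fam, (cntE x y p.1 (pth p) : ℝ) ≠ 0 from hxy)
      exact dN_edge (cntE_ne (hp p hpF) (by exact_mod_cast hpn)))
    (by
      rw [hμsum, ← mul_div_assoc, lt_div_iff₀ hYpos]
      have : (3 * Y.card : ℝ) < 2 ^ T := by exact_mod_cast hT
      nlinarith) Y.card Y (Finset.Subset.refl _) le_rfl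
  refine ⟨f, R, hdec, ?_⟩
  have hbw : backW w f Y = ∑ p ∈ Fam, (walkLen (backI f) p.1 (pth p) : ℝ) := by
    rw [← lin]
    unfold backW
    refine Finset.sum_congr rfl fun x _ => Finset.sum_congr rfl fun y _ => ?_
    unfold backI
    split_ifs <;> simp
  rw [hμsum, hbw] at hb
  set tot : ℝ := ∑ p ∈ Fam, (walkLen (backI f) p.1 (pth p) : ℝ) with htot
  have h1 : tot ≤ 12 * lam * A * Fam.card := by
    have hj : (0 : ℝ) < 2 ^ j := by positivity
    have hl' : (Nat.log 2 Y.card : ℝ) ≤ lam := by exact_mod_cast hYl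
    have h3 : (2 ^ j : ℝ) * tot ≤ 2 ^ j * (12 * lam * A * Fam.card) := by
      push_cast at hb
      calc (2 ^ j : ℝ) * tot ≤ 2 * (Nat.log 2 Y.card) * (3 * vol) := hb
        _ ≤ 2 * lam * (3 * (Fam.card * (A * 2 ^ (j + 1)))) := by gcongr
        _ = _ := by rw [pow_succ]; ring
    exact le_of_mul_le_mul_left h3 hj
  set bad := Fam.filter (fun p => ¬ walkLen (backI f) p.1 (pth p) ≤ 24 * lam * A) with hbad
  have h2 : (bad.card : ℝ) * (24 * lam * A) ≤ tot := by
    rw [← nsmul_eq_mul]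
    refine (Finset.card_nsmul_le_sum bad (fun p => (walkLen (backI f) p.1 (pth p) : ℝ)) _ ?_).trans
      (Finset.sum_le_sum_of_subset_of_nonneg (Finset.filter_subset _ _)
        fun _ _ _ => Nat.cast_nonneg _)
    intro p h
    have := (Finset.mem_filter.1 h).2
    have h4 : 24 * lam * A ≤ walkLen (backI f) p.1 (pth p) := by omega
    exact_mod_cast h4
  have h5 : (0 : ℝ) < 12 * lam * A := by
    have : (0 : ℝ) < lam := by exact_mod_cast hlam
    have : (0 : ℝ) < A := by exact_mod_cast hA
    positivity
  have h6 : (12 * lam * A : ℝ) * (2 * bad.card) ≤ 12 * lam * A * Fam.card := by linarith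
  have h7 := le_of_mul_le_mul_left h6 h5
  exact_mod_cast h7

end Family

section Mono
variable {V : Type*} {E : V → V → Prop}

/-- `τ i, …, τ (R-1)` followed by `b` full copies. -/
def Suf (τ : ℕ → List V) (R b i : ℕ) : List V :=
  ((List.range R).drop i).flatMap τ ++ (List.replicate b ((List.range R).flatMap τ)).flatten

theorem Suf_cons (τ : ℕ → List V) {R i : ℕ} (b : ℕ) (h : i < R) :
    Suf τ R b i = τ i ++ Suf τ R b (i + 1) := by
  unfold Suf
  rw [List.drop_eq_getElem_cons (by simpa using h)]
  simp

theorem Suf_zero (τ : ℕ → List V) (R b : ℕ) :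
    Suf τ R b 0 = (List.replicate (b + 1) ((List.range R).flatMap τ)).flatten := by
  simp [Suf, List.replicate_succ]

theorem Suf_mono (τ : ℕ → List V) {R i i' : ℕ} (b : ℕ) (h : i ≤ i') :
    (Suf τ R b i').Sublist (Suf τ R b i) := by
  unfold Suf
  refine List.Sublist.append ?_ (List.Sublist.refl _)
  rw [List.flatMap_def, List.flatMap_def]
  exact List.Sublist.flatten ((List.drop_sublist_drop_left _ h).map _)

theorem Suf_succ (τ : ℕ → List V) (R b i i' : ℕ) :
    (Suf τ R b i).Sublist (Suf τ R (b + 1) i') := by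
  refine (Suf_mono τ b (Nat.zero_le i)).trans ?_
  rw [Suf_zero]
  exact List.sublist_append_right _ _

theorem mono_cov (g : V → V → ℕ) (Y : Finset V) (f : V → ℕ) (R : ℕ) (τ : ℕ → List V)
    (Good : ℕ → Prop) (B : ℕ) (η : ℝ) (hη : 0 ≤ η) (hR : ∀ y ∈ Y, f y < R)
    (hτ : ∀ i, Good i → ∀ s t l, s ∈ Y.filter (fun y => f y = i) →
      IsWalk (rE E (Y.filter (fun y => f y = i))) s t l → walkLen g s l < B →
      Cov E g (τ i) s t ((1 + η) * walkLen g s l)) :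
    ∀ (l : List V) (s t : V) (b : ℕ), s ∈ Y → IsWalk (rE E Y) s t l →
      (∀ x ∈ s :: l, Good (f x)) → walkLen (backI f) s l ≤ b → walkLen g s l < B →
      Cov E g (Suf τ R b (f s)) s t ((1 + η) * walkLen g s l) := by
  -- structural invariant
  have main : ∀ (l : List V) (s t : V) (b : ℕ), s ∈ Y → IsWalk (rE E Y) s t l →
      (∀ x ∈ s :: l, Good (f x)) → walkLen (backI f) s l ≤ b → walkLen g s l < B →
      ∃ u l1, IsWalk (rE E (Y.filter (fun y => f y = f s))) s u l1 ∧
        ((u = t ∧ walkLen g s l1 = walkLen g s l) ∨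
          ∃ v L2, E u v ∧ Cov E g (Suf τ R b (f s + 1)) v t L2 ∧
            (1 + η) * walkLen g s l1 + g u v + L2 ≤ (1 + η) * walkLen g s l) ∧
        walkLen g s l1 ≤ walkLen g s l := by
    have fin : ∀ (l : List V) (s t : V) (b : ℕ), s ∈ Y → Good (f s) → walkLen g s l < B →
        (∃ u l1, IsWalk (rE E (Y.filter (fun y => f y = f s))) s u l1 ∧
        ((u = t ∧ walkLen g s l1 = walkLen g s l) ∨
          ∃ v L2, E u v ∧ Cov E g (Suf τ R b (f s + 1)) v t L2 ∧
            (1 + η) * walkLen g s l1 + g u v + L2 ≤ (1 + η) * walkLen g s l) ∧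
        walkLen g s l1 ≤ walkLen g s l) →
        Cov E g (Suf τ R b (f s)) s t ((1 + η) * walkLen g s l) := by
      rintro l s t b hs hG hB ⟨u, l1, h1, h2, h3⟩
      have hc := hτ (f s) hG s u l1 (by simp [hs]) h1 (by omega)
      rw [Suf_cons τ b (hR s hs)]
      rcases h2 with ⟨rfl, h2⟩ | ⟨v, L2, hE, hC, hL⟩
      · rw [h2] at hc
        exact hc.mono (List.sublist_append_left _ _) le_rfl
      · exact (hc.edge hE hC).mono (List.Sublist.refl _) hL
    intro l
    induction l with
    | nil =>
      intro s t b hs hl _ _ _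
      exact ⟨s, [], rfl, Or.inl ⟨hl, rfl⟩, le_rfl⟩
    | cons v l ih =>
      intro s t b hs hl hG hb hB
      have hv : v ∈ Y := hl.1.2.1
      simp only [walkLen] at hb hB ⊢
      have hG' : ∀ x ∈ v :: l, Good (f x) := fun x hx => hG x (List.mem_cons_of_mem _ hx)
      by_cases hfv : f v = f s
      · obtain ⟨u, l1, h1, h2, h3⟩ := ih v t b hv hl.2 hG' (by omega) (by omega)
        rw [hfv] at h1 h2
        refine ⟨u, v :: l1, ⟨⟨by simp [hs], by simp [hv, hfv], hl.1.2.2⟩, h1⟩, ?_, ?_⟩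
        · simp only [walkLen]
          rcases h2 with ⟨h2, h4⟩ | ⟨v', L2, hE, hC, hL⟩
          · exact Or.inl ⟨h2, by omega⟩
          · refine Or.inr ⟨v', L2, hE, hC, ?_⟩
            push_cast; linarith
        · simp only [walkLen]; omega
      · have hcov : Cov E g (Suf τ R b (f s + 1)) v t ((1 + η) * walkLen g v l) := by
          rcases Nat.lt_or_gt_of_ne hfv with h | h
          · have hbk : backI f s v = 1 := by simp [backI, h]
            obtain ⟨b', rfl⟩ : ∃ b', b = b' + 1 := ⟨b - 1, by omega⟩
            exact (fin l v t b' hv (hG' v (by simp)) (by omega)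
              (ih v t b' hv hl.2 hG' (by omega) (by omega))).mono (Suf_succ _ _ _ _ _) le_rfl
          · exact (fin l v t b hv (hG' v (by simp)) (by omega)
              (ih v t b hv hl.2 hG' (by omega) (by omega))).mono (Suf_mono _ _ h) le_rfl
        refine ⟨s, [], rfl, Or.inr ⟨v, _, hl.1.2.2, hcov, ?_⟩, by simp [walkLen]⟩
        simp only [walkLen]
        push_cast
        have : (0 : ℝ) ≤ η * g s v := by positivity
        linarith
  intro l s t b hs hl hG hb hB
  obtain ⟨u, l1, h1, h2, h3⟩ := main l s t b hs hl hG hb hB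
  have hc := hτ (f s) (hG s (by simp)) s u l1 (by simp [hs]) h1 (by omega)
  rw [Suf_cons τ b (hR s hs)]
  rcases h2 with ⟨rfl, h2⟩ | ⟨v, L2, hE, hC, hL⟩
  · rw [h2] at hc
    exact hc.mono (List.sublist_append_left _ _) le_rfl
  · exact (hc.edge hE hC).mono (List.Sublist.refl _) hL

theorem count_range_flatMap (τ : ℕ → List V) (f : V → ℕ) (W : ℕ) (v : V)
    (h1 : ∀ i, v ∈ τ i → f v = i) (h2 : ∀ i, (τ i).count v ≤ W) (R : ℕ) :
    ((List.range R).flatMap τ).count v ≤ if f v < R then W else 0 := by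
  induction R with
  | zero => simp
  | succ R ih =>
    rw [List.range_succ, List.flatMap_append, List.count_append]
    simp only [List.flatMap_cons, List.flatMap_nil, List.append_nil]
    by_cases h : f v = R
    · have := h2 R
      simp only [h, lt_irrefl, if_false] at ih
      simp [h]; omega
    · have h3 : (τ R).count v = 0 := List.count_eq_zero.2 fun hv => h (h1 R hv)
      rw [h3]
      split_ifs at ih ⊢ <;> omega

theorem count_flatMap_le {ι : Type*} (L : List ι) (τ : ι → List V) (v : V) (W : ℕ)
    (h : ∀ i ∈ L, (τ i).count v ≤ W) : (L.flatMap τ).count v ≤ L.length * W := by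
  induction L with
  | nil => simp
  | cons i L ih =>
    rw [List.flatMap_cons, List.count_append, List.length_cons]
    have h1 := h i (by simp)
    have h2 := ih fun k hk => h k (by simp [hk])
    nlinarith

end Mono

section Inner
variable {V : Type*} {E : V → V → Prop}

/-- `σ` covers all walks inside `Y` of length `< B` up to the factor `1 + η`. -/
def GoodSeq (E : V → V → Prop) (g : V → V → ℕ) (B : ℕ) (η : ℝ) (W : ℕ) (Y : Finset V)
    (σ : List V) : Prop :=
  (∀ v ∈ σ, v ∈ Y) ∧ (∀ v, σ.count v ≤ W) ∧
    ∀ s t l, s ∈ Y → IsWalk (rE E Y) s t l → walkLen g s l < B →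
      Cov E g σ s t ((1 + η) * walkLen g s l)

theorem step_f (g : V → V → ℕ) (Y : Finset V) (A T j C m M q B W : ℕ) (η : ℝ) (hη : 0 ≤ η)
    (hpos : ∀ x y, E x y → 0 < g x y) (hηA : (4 * T : ℝ) ≤ η * A)
    (hYM : Y.card ≤ M * m) (hC : A * 2 ^ (j + 1) + 2 * T * 2 ^ j < C)
    (hIH : ∀ Z : Finset V, Z.card ≤ m → ∃ σ, GoodSeq E g B η W Z σ)
    (f : V → ℕ) (R : ℕ) (hdec : IsDec (dN (rE E Y) g C) m (2 * T * 2 ^ j) f R Y) :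
    ∃ σ : List V, (∀ v ∈ σ, v ∈ Y) ∧ (∀ v, σ.count v ≤ (q + 1) * W + 2 * M) ∧
      ∀ s t l, s ∈ Y → IsWalk (rE E Y) s t l → walkLen g s l = dN (rE E Y) g C s t →
        A * 2 ^ j ≤ walkLen g s l → walkLen g s l < A * 2 ^ (j + 1) → walkLen g s l < B →
        walkLen (backI f) s l ≤ q →
        Cov E g σ s t ((1 + η) * walkLen g s l) := by
  set fib : ℕ → Finset V := fun i => Y.filter (fun y => f y = i) with hfib
  set Good : ℕ → Prop := fun i => (fib i).card ≤ m with hGood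
  have hτex : ∀ i, ∃ σ : List V, (∀ v ∈ σ, v ∈ fib i) ∧ (∀ v, σ.count v ≤ W) ∧
      (Good i → GoodSeq E g B η W (fib i) σ) := by
    intro i
    by_cases h : Good i
    · obtain ⟨σ, hσ⟩ := hIH (fib i) h
      exact ⟨σ, hσ.1, hσ.2.1, fun _ => hσ⟩
    · exact ⟨[], by simp, by simp, fun h' => absurd h' h⟩
  choose τ hτ1 hτ2 hτ3 using hτex
  have hlmex : ∀ i, ∃ σ : List V, (∀ v ∈ σ, v ∈ Y) ∧ (∀ v, σ.count v ≤ 2) ∧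
      (¬ Good i → ∃ r ∈ fib i, ∀ s ∈ Y, ∀ t, dN (rE E Y) g C s r < C → dN (rE E Y) g C r t < C →
        Cov E g σ s t ((dN (rE E Y) g C s r : ℝ) + dN (rE E Y) g C r t)) := by
    intro i
    by_cases h : Good i
    · exact ⟨[], by simp, by simp, fun h' => absurd h h'⟩
    · obtain ⟨r, hr⟩ : (fib i).Nonempty := Finset.card_pos.1 (by simp only [hGood] at h; omega)
      obtain ⟨σ, h1, h2, h3⟩ := landmark (g := g) hpos C r (Finset.mem_filter.1 hr).1
      exact ⟨σ, h1, h2, fun _ => ⟨r, hr, h3⟩⟩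
  choose lm hlm1 hlm2 hlm3 using hlmex
  set big : Finset ℕ := (Finset.range R).filter (fun i => ¬ Good i) with hbig
  have hbigcard : big.card ≤ M := by
    by_contra! hcon
    have h1 : big.card * (m + 1) ≤ ∑ i ∈ big, (fib i).card := by
      rw [← smul_eq_mul]
      refine Finset.card_nsmul_le_sum _ _ _ fun i hi => ?_
      have := (Finset.mem_filter.1 hi).2
      simp only [hGood] at this; omega
    have h2 : ∑ i ∈ big, (fib i).card ≤ Y.card := by
      rw [← Finset.card_biUnion]
      · exact Finset.card_le_card (Finset.biUnion_subset.2 fun i _ => Finset.filter_subset _ _)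
      · intro a _ b _ hab
        rw [Function.onFun, Finset.disjoint_left]
        intro x hx hx'
        simp only [hfib, Finset.mem_filter] at hx hx'
        exact hab (hx.2.symm.trans hx'.2)
    nlinarith
  refine ⟨Suf τ R q 0 ++ big.toList.flatMap lm, ?_, ?_, ?_⟩
  · intro v hv
    rcases List.mem_append.1 hv with h | h
    · rw [Suf_zero] at h
      obtain ⟨L, hL, hvL⟩ := List.mem_flatten.1 h
      rw [List.eq_of_mem_replicate hL] at hvL
      obtain ⟨i, -, hi⟩ := List.mem_flatMap.1 hvL
      exact (Finset.mem_filter.1 (hτ1 i v hi)).1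
    · obtain ⟨i, -, hi⟩ := List.mem_flatMap.1 h
      exact hlm1 i v hi
  · intro v
    rw [List.count_append]
    refine Nat.add_le_add ?_ ?_
    · rw [Suf_zero]
      have h0 : ((List.range R).flatMap τ).count v ≤ W := by
        have := count_range_flatMap τ f W v (fun i hi => (Finset.mem_filter.1 (hτ1 i v hi)).2)
          (fun i => hτ2 i v) R
        split_ifs at this <;> omega
      have := count_flatMap_le (List.replicate (q + 1) ((List.range R).flatMap τ)) id v W
        (fun L hL => by rw [List.eq_of_mem_replicate hL]; exact h0)
      simpa using this
    · have := count_flatMap_le big.toList lm v 2 (fun i _ => hlm2 i v)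
      rw [Finset.length_toList] at this
      omega
  · intro s t l hs hl hd hlo hhi hB hback
    by_cases hall : ∀ x ∈ s :: l, Good (f x)
    · have := mono_cov g Y f R τ Good B η hη hdec.1 (fun i hi => (hτ3 i hi).2.2) l s t q hs hl hall
        hback hB
      exact this.mono ((Suf_mono _ _ (Nat.zero_le _)).trans (List.sublist_append_left _ _)) le_rfl
    · push Not at hall
      obtain ⟨y, hyl, hyb⟩ := hall
      have hyY := isWalk_rE_mem hs hl y hyl
      obtain ⟨r, hr, hcov⟩ := hlm3 (f y) hyb
      obtain ⟨hrY, hrf⟩ := Finset.mem_filter.1 hr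
      have hdiam : ∀ a ∈ Y, ∀ b ∈ Y, f a = f y → f b = f y →
          dN (rE E Y) g C a b ≤ 2 * T * 2 ^ j := (hdec.2 (f y)).resolve_left hyb
      have d1 := hdiam y hyY r hrY rfl hrf
      have d2 := hdiam r hrY y hyY hrf rfl
      obtain ⟨l1, l2, rfl, w1, w2⟩ := isWalk_split hl hyl
      have e := walkLen_append g (l2 := l2) w1
      have d3 := dN_le (g := g) (C := C) w1
      have d4 := dN_le (g := g) (C := C) w2
      have t1 := dN_tri (E := rE E Y) (g := g) (C := C) s y r
      have t2 := dN_tri (E := rE E Y) (g := g) (C := C) r y t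
      have hc := hcov s hs t (by omega) (by omega)
      refine hc.mono ?_ ?_
      · refine List.Sublist.trans ?_ (List.sublist_append_right _ _)
        rw [List.flatMap_def]
        refine List.sublist_flatten_of_mem (List.mem_map.2 ⟨f y, ?_, rfl⟩)
        simp only [Finset.mem_toList, hbig, Finset.mem_filter, Finset.mem_range]
        exact ⟨hdec.1 y hyY, hyb⟩
      · have n1 : dN (rE E Y) g C s r + dN (rE E Y) g C r t
            ≤ walkLen g s (l1 ++ l2) + 4 * T * 2 ^ j := by
          have : 4 * T * 2 ^ j = 2 * T * 2 ^ j + 2 * T * 2 ^ j := by ring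
          omega
        have n2 : (dN (rE E Y) g C s r : ℝ) + dN (rE E Y) g C r t
            ≤ walkLen g s (l1 ++ l2) + 4 * T * 2 ^ j := by exact_mod_cast n1
        have n3 : (A * 2 ^ j : ℝ) ≤ walkLen g s (l1 ++ l2) := by exact_mod_cast hlo
        have n4 : (4 * T * 2 ^ j : ℝ) ≤ η * A * 2 ^ j :=
          mul_le_mul_of_nonneg_right hηA (by positivity)
        have n5 := mul_le_mul_of_nonneg_left n3 hη
        linarith

theorem step_K (g : V → V → ℕ) (Y : Finset V) (A T j C m M B W lam : ℕ) (η : ℝ) (hη : 0 ≤ η)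
    (hpos : ∀ x y, E x y → 0 < g x y) (hηA : (4 * T : ℝ) ≤ η * A) (hA : 0 < A) (hlam : 0 < lam)
    (hYl : Nat.log 2 Y.card ≤ lam) (hT : 3 * Y.card < 2 ^ T)
    (hYM : Y.card ≤ M * m) (hC : A * 2 ^ (j + 1) + 2 * T * 2 ^ j < C)
    (hIH : ∀ Z : Finset V, Z.card ≤ m → ∃ σ, GoodSeq E g B η W Z σ)
    (pth : V × V → List V) (K : ℕ) :
    ∀ Fam : Finset (V × V), Fam.card < 2 ^ K →
      (∀ p ∈ Fam, p.1 ∈ Y ∧ IsWalk (rE E Y) p.1 p.2 (pth p) ∧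
        walkLen g p.1 (pth p) = dN (rE E Y) g C p.1 p.2 ∧ A * 2 ^ j ≤ walkLen g p.1 (pth p) ∧
        walkLen g p.1 (pth p) < A * 2 ^ (j + 1) ∧ walkLen g p.1 (pth p) < B) →
      ∃ σ : List V, (∀ v ∈ σ, v ∈ Y) ∧
        (∀ v, σ.count v ≤ K * ((24 * lam * A + 1) * W + 2 * M)) ∧
        ∀ p ∈ Fam, Cov E g σ p.1 p.2 ((1 + η) * walkLen g p.1 (pth p)) := by
  induction K with
  | zero =>
    intro Fam hF _
    have : Fam = ∅ := Finset.card_eq_zero.1 (by simpa using hF)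
    subst this
    exact ⟨[], by simp, by simp, by simp⟩
  | succ K ih =>
    intro Fam hF hp
    rcases Fam.eq_empty_or_nonempty with rfl | hne
    · exact ⟨[], by simp, by simp, by simp⟩
    obtain ⟨f, R, hdec, hhalf⟩ := half_lemma (E := E) g Y Fam pth A T j C m lam hA hlam hYl hT
      (fun p h => (hp p h).1) (fun p h => (hp p h).2.1) (fun p h => (hp p h).2.2.2.2.1.le)
      (fun p h => lt_of_lt_of_le (by positivity) (hp p h).2.2.2.1) hne
    obtain ⟨σ₁, a1, a2, a3⟩ := step_f g Y A T j C m M (24 * lam * A) B W η hη hpos hηA hYM hC hIH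
      f R hdec
    obtain ⟨σ₂, b1, b2, b3⟩ := ih
      (Fam.filter (fun p => ¬ walkLen (backI f) p.1 (pth p) ≤ 24 * lam * A))
      (by rw [pow_succ] at hF; omega) (fun p h => hp p (Finset.mem_filter.1 h).1)
    refine ⟨σ₁ ++ σ₂, ?_, ?_, ?_⟩
    · intro v hv
      rcases List.mem_append.1 hv with h | h
      · exact a1 v h
      · exact b1 v h
    · intro v
      rw [List.count_append, Nat.succ_mul]
      have := a2 v
      have := b2 v
      omega
    · intro p h
      by_cases hq : walkLen (backI f) p.1 (pth p) ≤ 24 * lam * A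
      · obtain ⟨c1, c2, c3, c4, c5, c6⟩ := hp p h
        exact (a3 _ _ _ c1 c2 c3 c4 c5 c6 hq).mono (List.sublist_append_left _ _) le_rfl
      · exact (b3 p (Finset.mem_filter.2 ⟨h, hq⟩)).mono (List.sublist_append_right _ _) le_rfl

/-- width recursion -/
def Wr (A lam J M : ℕ) : ℕ → ℕ
  | 0 => 1
  | r + 1 => J * (2 * lam * ((24 * lam * A + 1) * Wr A lam J M r + 2 * M)) + 1

theorem inner (g : V → V → ℕ) (A T J M lam : ℕ) (η : ℝ) (hη : 0 ≤ η)
    (hgA : ∀ x y, E x y → A ≤ g x y) (hηA : (4 * T : ℝ) ≤ η * A) (hA : 0 < A) (hlam : 0 < lam)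
    (n : ℕ) (hn : n < 2 ^ lam) (hT : 3 * n < 2 ^ T) (r : ℕ) :
    ∀ Y : Finset V, Y.card ≤ n → Y.card ≤ M ^ r →
      ∃ σ, GoodSeq E g (A * 2 ^ J) η (Wr A lam J M r) Y σ := by
  have hpos : ∀ x y, E x y → 0 < g x y := fun x y h => lt_of_lt_of_le hA (hgA x y h)
  induction r with
  | zero =>
    intro Y _ hY
    refine ⟨Y.toList, fun v hv => Finset.mem_toList.1 hv, fun v =>
      List.nodup_iff_count_le_one.1 (Finset.nodup_toList _) v, ?_⟩
    intro s t l hs hl _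
    have ht := isWalk_last_mem hs hl
    have : s = t := Finset.card_le_one.1 (by simpa using hY) s hs t ht
    subst this
    exact Cov.refl (Finset.mem_toList.2 hs) (by positivity)
  | succ r ih =>
    intro Y hYn hY
    set C : ℕ := A * 2 ^ (J + 1) + 2 * T * 2 ^ J + 1 with hCdef
    have hYn' : Y.card < 2 ^ lam := by omega
    have hYl : Nat.log 2 Y.card ≤ lam := by
      rcases Nat.eq_zero_or_pos Y.card with h | h
      · simp [h]
      · exact (Nat.log_lt_of_lt_pow (by omega) hYn').le
    -- chosen shortest walks
    have hpth : ∀ p : V × V, ∃ l : List V, dN (rE E Y) g C p.1 p.2 < C →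
        IsWalk (rE E Y) p.1 p.2 l ∧ walkLen g p.1 l = dN (rE E Y) g C p.1 p.2 := by
      intro p
      by_cases h : dN (rE E Y) g C p.1 p.2 < C
      · obtain ⟨l, hl⟩ := dN_spec h
        exact ⟨l, fun _ => hl⟩
      · exact ⟨[], fun h' => absurd h' h⟩
    choose pth hpth using hpth
    have hCbig : ∀ j, j < J → A * 2 ^ (j + 1) + 2 * T * 2 ^ j < C := by
      intro j hj
      have h1 : A * 2 ^ (j + 1) ≤ A * 2 ^ (J + 1) :=
        Nat.mul_le_mul_left _ (Nat.pow_le_pow_right (by norm_num) (by omega))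
      have h2 : 2 * T * 2 ^ j ≤ 2 * T * 2 ^ J :=
        Nat.mul_le_mul_left _ (Nat.pow_le_pow_right (by norm_num) (by omega))
      omega
    set Fam : ℕ → Finset (V × V) := fun j => (Y ×ˢ Y).filter (fun p =>
      A * 2 ^ j ≤ dN (rE E Y) g C p.1 p.2 ∧ dN (rE E Y) g C p.1 p.2 < A * 2 ^ (j + 1)) with hFam
    have hex : ∀ j, ∃ σ : List V, (∀ v ∈ σ, v ∈ Y) ∧
        (∀ v, σ.count v ≤ 2 * lam * ((24 * lam * A + 1) * Wr A lam J M r + 2 * M)) ∧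
        (j < J → ∀ p ∈ Fam j, Cov E g σ p.1 p.2 ((1 + η) * walkLen g p.1 (pth p))) := by
      intro j
      by_cases hj : j < J
      · have hFc : (Fam j).card < 2 ^ (2 * lam) := by
          refine lt_of_le_of_lt (Finset.card_filter_le _ _) ?_
          rw [Finset.card_product, two_mul, pow_add]
          nlinarith
        by_cases hm : M ^ r ≤ n
        · obtain ⟨σ, h1, h2, h3⟩ := step_K (E := E) g Y A T j C (M ^ r) M (A * 2 ^ J)
            (Wr A lam J M r) lam η hη
            hpos hηA hA hlam hYl (by omega) (by rw [pow_succ] at hY; linarith) (hCbig j hj)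
            (fun Z hZ => ih Z (by omega) hZ) pth (2 * lam) (Fam j) hFc (by
              intro p hp
              simp only [hFam, Finset.mem_filter, Finset.mem_product] at hp
              have hlt := hCbig j hj
              obtain ⟨w1, w2⟩ := hpth p (by omega)
              refine ⟨hp.1.1, w1, w2, by omega, by omega, ?_⟩
              have h1 : A * 2 ^ (j + 1) ≤ A * 2 ^ J :=
                Nat.mul_le_mul_left _ (Nat.pow_le_pow_right (by norm_num) (by omega))
              omega)
          exact ⟨σ, h1, h2, fun _ => h3⟩
        · obtain ⟨σ, h1, h2, h3⟩ := ih Y hYn (by omega)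
          refine ⟨σ, h1, fun v => (h2 v).trans ?_, fun _ p hp => ?_⟩
          · have : 1 ≤ 2 * lam := by omega
            have h5 : Wr A lam J M r ≤ (24 * lam * A + 1) * Wr A lam J M r + 2 * M := by
              rw [add_mul]; omega
            calc Wr A lam J M r ≤ 1 * ((24 * lam * A + 1) * Wr A lam J M r + 2 * M) := by omega
              _ ≤ _ := Nat.mul_le_mul_right _ this
          · simp only [hFam, Finset.mem_filter, Finset.mem_product] at hp
            have hlt := hCbig j hj
            obtain ⟨w1, w2⟩ := hpth p (by omega)
            refine h3 _ _ _ hp.1.1 w1 ?_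
            have h1 : A * 2 ^ (j + 1) ≤ A * 2 ^ J :=
              Nat.mul_le_mul_left _ (Nat.pow_le_pow_right (by norm_num) (by omega))
            omega
      · exact ⟨[], by simp, by simp, fun h => absurd h hj⟩
    choose σj s1 s2 s3 using hex
    refine ⟨(List.range J).flatMap σj ++ Y.toList, ?_, ?_, ?_⟩
    · intro v hv
      rcases List.mem_append.1 hv with h | h
      · obtain ⟨i, -, hi⟩ := List.mem_flatMap.1 h
        exact s1 i v hi
      · exact Finset.mem_toList.1 h
    · intro v
      rw [List.count_append]
      have h1 := count_flatMap_le (List.range J) σj v _ (fun i _ => s2 i v)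
      have h2 := List.nodup_iff_count_le_one.1 (Finset.nodup_toList Y) v
      rw [List.length_range] at h1
      exact Nat.add_le_add h1 h2
    · intro s t l hs hl hlen
      have ht := isWalk_last_mem hs hl
      by_cases hst : s = t
      · subst hst
        exact Cov.refl (List.mem_append_right _ (Finset.mem_toList.2 hs)) (by positivity)
      have hd1 := dN_le (g := g) (C := C) hl
      have hJC : A * 2 ^ J ≤ C := by
        have : A * 2 ^ J ≤ A * 2 ^ (J + 1) :=
          Nat.mul_le_mul_left _ (Nat.pow_le_pow_right (by norm_num) (by omega))
        omega
      obtain ⟨w1, w2⟩ := hpth (s, t) (by simp only; omega)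
      simp only at w1 w2
      have hdA : A ≤ dN (rE E Y) g C s t := by
        cases hl' : pth (s, t) with
        | nil => rw [hl'] at w1; exact absurd w1 hst
        | cons v l' =>
          rw [hl'] at w1 w2
          have := hgA _ _ w1.1.2.2
          simp only [walkLen] at w2
          omega
      set D := dN (rE E Y) g C s t with hD
      have hq0 : D / A ≠ 0 := by
        have := Nat.div_pos hdA hA; omega
      set j := Nat.log 2 (D / A) with hj
      have j1 : A * 2 ^ j ≤ D := by
        have := Nat.pow_log_le_self 2 hq0
        calc A * 2 ^ j ≤ A * (D / A) := Nat.mul_le_mul_left _ this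
          _ ≤ D := Nat.mul_div_le D A
      have j2 : D < A * 2 ^ (j + 1) := by
        have h1 : D / A < 2 ^ (j + 1) := Nat.lt_pow_succ_log_self (by norm_num) _
        rw [Nat.div_lt_iff_lt_mul hA] at h1
        linarith
      have j3 : j < J := by
        have h1 : A * 2 ^ j < A * 2 ^ J := by omega
        exact (Nat.pow_lt_pow_iff_right (by norm_num)).1 (Nat.lt_of_mul_lt_mul_left h1)
      have hc := s3 j j3 (s, t) (by
        simp only [hFam, Finset.mem_filter, Finset.mem_product]
        exact ⟨⟨hs, ht⟩, j1, j2⟩)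
      simp only at hc
      refine hc.mono ?_ ?_
      · refine List.Sublist.trans ?_ (List.sublist_append_left _ _)
        rw [List.flatMap_def]
        exact List.sublist_flatten_of_mem (List.mem_map.2 ⟨j, by simpa using j3, rfl⟩)
      · rw [w2]
        have : (D : ℝ) ≤ walkLen g s l := by exact_mod_cast hd1
        exact mul_le_mul_of_nonneg_left this (by linarith)

end Inner

section Final

theorem isDag_of_rank {N : ℕ} (ED : Fin N → Fin N → Prop) (h : ∀ x y, ED x y → x < y) :
    IsDag ED := by
  intro x hx
  have : ∀ a b, Relation.TransGen ED a b → a < b := by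
    intro a b hab
    induction hab with
    | single h1 => exact h _ _ h1
    | tail _ h1 ih => exact ih.trans (h _ _ h1)
  exact lt_irrefl _ (this x x hx)

theorem walk_project {V D : Type*} {E : V → V → Prop} {g : V → V → ℕ} {ED : D → D → Prop}
    {gD : D → D → ℕ} {π : D → V}
    (h : ∀ x y, ED x y → E (π x) (π y) ∧ gD x y = g (π x) (π y)) {a b : D} {l : List D}
    (hl : IsWalk ED a b l) :
    IsWalk E (π a) (π b) (l.map π) ∧ walkLen g (π a) (l.map π) = walkLen gD a l := by
  induction l generalizing a with
  | nil => simp only [IsWalk] at hl; subst hl; exact ⟨rfl, rfl⟩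
  | cons v l ih =>
    obtain ⟨h1, h2⟩ := ih hl.2
    obtain ⟨h3, h4⟩ := h _ _ hl.1
    exact ⟨⟨h3, h1⟩, by simp only [List.map_cons, walkLen, h2, h4]⟩

theorem walk_lift {V : Type*} {E : V → V → Prop} (g : V → V → ℕ) {N : ℕ} (π : Fin N → V)
    {t : V} : ∀ (is : List (Fin N)) (a : Fin N), (a :: is).Pairwise (· < ·) →
      IsWalk E (π a) t (is.map π) → ∃ b, π b = t ∧
      IsWalk (fun i j => i < j ∧ E (π i) (π j)) a b is ∧
      walkLen (fun i j => g (π i) (π j)) a is = walkLen g (π a) (is.map π) := by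
  intro is
  induction is with
  | nil => intro a _ h; exact ⟨a, h, rfl, rfl⟩
  | cons v is ih =>
    intro a hp h
    obtain ⟨b, h1, h2, h3⟩ := ih v (List.pairwise_cons.1 hp).2 h.2
    exact ⟨b, h1, ⟨⟨(List.pairwise_cons.1 hp).1 v (by simp), h.1⟩, h2⟩,
      by simp only [List.map_cons, walkLen, h3]⟩

theorem dag_of_seq (VG : Type) [Finite VG] (EG : VG → VG → Prop) (ℓG : VG → VG → ℕ) (c ε : ℝ)
    (hε : 0 < ε) (hn : 0 < Nat.card VG) (W : ℕ) (hW : (W : ℝ) ≤ (Nat.card VG : ℝ) ^ c)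
    (σ : List VG) (hσ : ∀ v, σ.count v ≤ W)
    (hcov : ∀ s t l, IsWalk EG s t l → Cov EG ℓG σ s t ((1 + ε) * walkLen ℓG s l)) :
    ∃ (VD : Type) (_ : Finite VD) (ED : VD → VD → Prop) (ℓD : VD → VD → ℕ)
        (π : VD → VG),
        IsDag ED ∧
        (∀ x y, ED x y → EG (π x) (π y) ∧ ℓD x y = ℓG (π x) (π y)) ∧
        (∀ v : VG, ((π ⁻¹' {v}).ncard : ℝ) ≤ (Nat.card VG : ℝ) ^ c) ∧
        (∀ s t : VG,
          gdist EG ℓG s t ≤ gdistSet ED ℓD (π ⁻¹' {s}) (π ⁻¹' {t}) ∧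
          gdistSet ED ℓD (π ⁻¹' {s}) (π ⁻¹' {t}) ≤
            (1 + ENNReal.ofReal ε) * gdist EG ℓG s t) ∧
        ((Nat.card VD : ℝ) ≤ (Nat.card VG : ℝ) ^ (1 + c)) ∧
        (({p : VD × VD | ED p.1 p.2}.ncard : ℝ) ≤
          ({p : VG × VG | EG p.1 p.2}.ncard : ℝ) * (Nat.card VG : ℝ) ^ (2 * c)) := by
  have := Fintype.ofFinite VG
  set π : Fin σ.length → VG := fun i => σ[i] with hπ
  set ED : Fin σ.length → Fin σ.length → Prop := fun i j => i < j ∧ EG (π i) (π j) with hED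
  set ℓD : Fin σ.length → Fin σ.length → ℕ := fun i j => ℓG (π i) (π j) with hℓD
  have hhom : ∀ x y, ED x y → EG (π x) (π y) ∧ ℓD x y = ℓG (π x) (π y) :=
    fun x y h => ⟨h.2, rfl⟩
  have hfibF : ∀ v, (Finset.univ.filter (fun i => π i = v)).card ≤ W := by
    intro v
    refine le_trans (le_of_eq ?_) (hσ v)
    have e : σ = List.ofFn π := by simp [hπ]
    have h2 : σ.count v = (List.ofFn π).count v := by rw [← e]
    rw [h2, List.count, List.countP_eq_length_filter, List.ofFn_eq_map, List.filter_map,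
      List.length_map]
    rw [← List.toFinset_card_of_nodup ((List.nodup_finRange _).filter _)]
    congr 1
    ext i
    simp
  have hfib : ∀ v, (π ⁻¹' {v}).ncard ≤ W := by
    intro v
    rw [show π ⁻¹' {v} = ((Finset.univ.filter (fun i => π i = v) : Finset _) : Set _) by
      ext i; simp, Set.ncard_coe_finset]
    exact hfibF v
  have hnR : (0 : ℝ) < Nat.card VG := by exact_mod_cast hn
  refine ⟨Fin σ.length, inferInstance, ED, ℓD, π, isDag_of_rank ED fun x y h => h.1, hhom,
    ?_, ?_, ?_, ?_⟩
  · intro v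
    exact le_trans (by exact_mod_cast hfib v) hW
  · intro s t
    constructor
    · unfold gdistSet
      refine le_iInf₂ fun a ha => le_iInf₂ fun b hb => ?_
      simp only [Set.mem_preimage, Set.mem_singleton_iff] at ha hb
      unfold gdist
      refine le_iInf₂ fun l hl => ?_
      obtain ⟨h1, h2⟩ := walk_project hhom hl
      rw [ha, hb] at h1
      rw [ha] at h2
      rw [← h2]
      exact iInf₂_le _ h1
    · have hne0 : (1 + ENNReal.ofReal ε) ≠ 0 := by simp
      have hneT : (1 + ENNReal.ofReal ε) ≠ ⊤ := by simp
      have key : ∀ l, IsWalk EG s t l → gdistSet ED ℓD (π ⁻¹' {s}) (π ⁻¹' {t}) ≤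
          (1 + ENNReal.ofReal ε) * (walkLen ℓG s l : ℝ≥0∞) := by
        intro l hl
        obtain ⟨l', h1, h2, h3⟩ := hcov s t l hl
        obtain ⟨is, his, hpw⟩ := List.sublist_eq_map_getElem h2
        cases is with
        | nil => simp at his
        | cons a is =>
          have his' : s :: l' = π a :: is.map π := his
          injection his' with e1 e2
          subst e1 e2
          obtain ⟨b, hb, hw, hlen⟩ := walk_lift ℓG π is a hpw h1
          have hle : gdistSet ED ℓD (π ⁻¹' {π a}) (π ⁻¹' {t}) ≤ (walkLen ℓD a is : ℝ≥0∞) := by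
            unfold gdistSet
            refine (iInf₂_le a (by simp)).trans ((iInf₂_le b (by simp [hb])).trans ?_)
            exact iInf₂_le is hw
          refine hle.trans ?_
          have e3 : walkLen ℓD a is = walkLen ℓG (π a) (is.map π) := hlen
          rw [e3]
          have h4 : (1 + ENNReal.ofReal ε) * (walkLen ℓG (π a) l : ℝ≥0∞)
              = ENNReal.ofReal ((1 + ε) * walkLen ℓG (π a) l) := by
            rw [ENNReal.ofReal_mul (by linarith), ENNReal.ofReal_add zero_le_one hε.le,
              ENNReal.ofReal_one, ENNReal.ofReal_natCast]
          rw [h4, ← ENNReal.ofReal_natCast]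
          exact ENNReal.ofReal_le_ofReal h3
      unfold gdist
      rw [ENNReal.mul_iInf_of_ne hne0 hneT]
      refine le_iInf fun l => ?_
      rw [ENNReal.mul_iInf_of_ne hne0 hneT]
      exact le_iInf fun hl => key l hl
  · have h1 : (Finset.univ : Finset (Fin σ.length)).card ≤ W * (Finset.univ : Finset VG).card :=
      Finset.card_le_mul_card_image_of_maps_to (f := π) (fun _ _ => Finset.mem_univ _) W
        (fun v _ => hfibF v)
    rw [Finset.card_univ, Finset.card_univ, Fintype.card_fin, ← Nat.card_eq_fintype_card] at h1
    rw [Real.rpow_add hnR, Real.rpow_one, Nat.card_eq_fintype_card (α := Fin σ.length),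
      Fintype.card_fin]
    calc (σ.length : ℝ) ≤ W * Nat.card VG := by exact_mod_cast h1
      _ ≤ (Nat.card VG : ℝ) ^ c * Nat.card VG := by gcongr
      _ = _ := mul_comm _ _
  · set S : Finset (Fin σ.length × Fin σ.length) := Finset.univ.filter (fun p => ED p.1 p.2) with hS
    set S' : Finset (VG × VG) := Finset.univ.filter (fun p => EG p.1 p.2) with hS'
    rw [show {p : Fin σ.length × Fin σ.length | ED p.1 p.2} = (S : Set _) by ext; simp [hS],
      show {p : VG × VG | EG p.1 p.2} = (S' : Set _) by ext; simp [hS'],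
      Set.ncard_coe_finset, Set.ncard_coe_finset]
    have h1 : S.card ≤ (W * W) * S'.card := by
      refine Finset.card_le_mul_card_image_of_maps_to (f := fun p => (π p.1, π p.2)) ?_ _ ?_
      · intro p hp
        simp only [hS, hS', Finset.mem_filter, Finset.mem_univ, true_and] at hp ⊢
        exact hp.2
      · rintro ⟨x, y⟩ _
        calc _ ≤ ((Finset.univ.filter (fun i => π i = x)) ×ˢ
              (Finset.univ.filter (fun i => π i = y))).card := by
              refine Finset.card_le_card fun p hp => ?_
              simp only [Finset.mem_filter, Prod.mk.injEq] at hp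
              simp [hp.2.1, hp.2.2]
          _ ≤ W * W := by
              rw [Finset.card_product]
              exact Nat.mul_le_mul (hfibF x) (hfibF y)
    have h2 : (Nat.card VG : ℝ) ^ (2 * c) = (Nat.card VG : ℝ) ^ c * (Nat.card VG : ℝ) ^ c := by
      rw [two_mul, Real.rpow_add hnR]
    rw [h2]
    calc (S.card : ℝ) ≤ (W * W) * S'.card := by exact_mod_cast h1
      _ ≤ ((Nat.card VG : ℝ) ^ c * (Nat.card VG : ℝ) ^ c) * S'.card := by gcongr
      _ = _ := mul_comm _ _

theorem walkLen_scale {V : Type*} (g : V → V → ℕ) (A Q : ℕ) (s : V) (l : List V) :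
    walkLen (fun x y => A * (Q * g x y + 1)) s l = A * (Q * walkLen g s l + l.length) := by
  induction l generalizing s with
  | nil => simp [walkLen]
  | cons v l ih => simp only [walkLen, ih, List.length_cons]; ring

theorem walkLen_le_of_bound {V : Type*} {E : V → V → Prop} (g : V → V → ℕ) (X : ℕ)
    (h : ∀ u v, E u v → g u v ≤ X) {s t : V} {l : List V} (hl : IsWalk E s t l) :
    walkLen g s l ≤ l.length * X := by
  induction l generalizing s with
  | nil => simp [walkLen]
  | cons v l ih =>
    have h1 := ih hl.2
    have h2 := h _ _ hl.1
    simp only [walkLen, List.length_cons, add_mul, one_mul]; omega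

theorem exists_seq (VG : Type) [Finite VG] (EG : VG → VG → Prop) (ℓG : VG → VG → ℕ) (k : ℕ)
    (n : ℕ) (hncard : Nat.card VG = n) (hn2 : 2 ≤ n) (hℓ : ∀ u v, EG u v → ℓG u v ≤ n ^ k)
    (ε : ℝ) (hε : 0 < ε) (hε1 : ε < 1) (hεn : 4 ≤ ε * n) (A lam M r : ℕ) (hA : 0 < A)
    (hlam : n < 2 ^ lam) (hAε : 8 * ((lam : ℝ) + 2) ≤ ε * A) (hM : n ≤ M ^ r) :
    ∃ σ : List VG, (∀ v, σ.count v ≤ Wr A lam ((k + 4) * lam) M r) ∧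
      ∀ s t l, IsWalk EG s t l → Cov EG ℓG σ s t ((1 + ε) * walkLen ℓG s l) := by
  have := Fintype.ofFinite VG
  have hcard : (Finset.univ : Finset VG).card = n := by
    rw [Finset.card_univ, ← Nat.card_eq_fintype_card, hncard]
  have hlam0 : 0 < lam := by
    rcases Nat.eq_zero_or_pos lam with h | h
    · subst h; simp at hlam; omega
    · exact h
  set g : VG → VG → ℕ := fun x y => A * (n ^ 2 * ℓG x y + 1) with hg
  obtain ⟨σ, -, h2, h3⟩ := inner (E := EG) g A (lam + 2) ((k + 4) * lam) M lam (ε / 2) (by positivity)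
    (fun x y _ => by simp only [hg]; nlinarith [Nat.zero_le (n ^ 2 * ℓG x y)])
    (by push_cast; linarith) hA hlam0 n hlam (by rw [pow_add]; omega) r Finset.univ
    hcard.le (hcard.le.trans hM)
  refine ⟨σ, h2, ?_⟩
  intro s t l hl
  obtain ⟨l', hl', hnd, hle⟩ := isWalk_simple ℓG hl
  have hlen' : l'.length < n := by
    have := List.Nodup.length_le_card hnd
    rw [← Nat.card_eq_fintype_card, hncard, List.length_cons] at this
    omega
  have hwl : walkLen ℓG s l' ≤ n * n ^ k :=
    (walkLen_le_of_bound ℓG _ hℓ hl').trans (Nat.mul_le_mul_right _ hlen'.le)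
  have hB : walkLen g s l' < A * 2 ^ ((k + 4) * lam) := by
    rw [hg, walkLen_scale]
    refine Nat.mul_lt_mul_of_pos_left ?_ hA
    have e1 : n ^ 2 * walkLen ℓG s l' ≤ n ^ (k + 3) := by
      calc _ ≤ n ^ 2 * (n * n ^ k) := Nat.mul_le_mul_left _ hwl
        _ = n ^ (k + 3) := by ring
    have e2 : n ≤ n ^ (k + 3) := Nat.le_self_pow (by omega) n
    have e3 : 2 * n ^ (k + 3) ≤ n ^ (k + 4) := by
      rw [pow_succ n (k + 3)]; nlinarith
    have e4 : n ^ (k + 4) < 2 ^ ((k + 4) * lam) := by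
      rw [mul_comm, pow_mul]
      exact Nat.pow_lt_pow_left hlam (by omega)
    omega
  obtain ⟨p, q1, q2, q3⟩ := h3 s t l' (Finset.mem_univ _)
    (isWalk_mono (fun x y h => ⟨Finset.mem_univ _, Finset.mem_univ _, h⟩) hl') hB
  refine ⟨p, q1, q2, ?_⟩
  rw [hg, walkLen_scale, walkLen_scale] at q3
  push_cast at q3
  set L : ℝ := (walkLen ℓG s l' : ℝ) with hL
  set P : ℝ := (walkLen ℓG s p : ℝ) with hP
  have hAR : (0 : ℝ) < A := by exact_mod_cast hA
  have hnR : (2 : ℝ) ≤ n := by exact_mod_cast hn2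
  have hlR : (l'.length : ℝ) ≤ n := by exact_mod_cast hlen'.le
  have hL0 : 0 ≤ L := Nat.cast_nonneg _
  have q4 : (n : ℝ) ^ 2 * P + p.length ≤ (1 + ε / 2) * (n ^ 2 * L + l'.length) := by
    have : (A : ℝ) * ((n : ℝ) ^ 2 * P + p.length)
      ≤ A * ((1 + ε / 2) * (n ^ 2 * L + l'.length)) := by linarith
    exact le_of_mul_le_mul_left this hAR
  have hpl : (0 : ℝ) ≤ p.length := Nat.cast_nonneg _
  have q5 : (n : ℝ) * (n * P) ≤ n * (n * ((1 + ε / 2) * L) + 3 / 2) := by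
    have : (1 + ε / 2) * (l'.length : ℝ) ≤ 3 / 2 * n := by
      have : (1 + ε / 2) ≤ 3 / 2 := by linarith
      exact mul_le_mul this hlR (Nat.cast_nonneg _) (by norm_num)
    nlinarith
  have q6 : (n : ℝ) * P ≤ n * ((1 + ε / 2) * L) + 3 / 2 :=
    le_of_mul_le_mul_left q5 (by linarith)
  have hgoal : P ≤ (1 + ε) * L := by
    rcases Nat.eq_zero_or_pos (walkLen ℓG s l') with h0 | h0
    · have hL00 : L = 0 := by rw [hL, h0]; simp
      rw [hL00] at q6 ⊢
      have hP1 : P < 1 := by nlinarith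
      have : walkLen ℓG s p < 1 := by
        rw [hP] at hP1
        exact_mod_cast hP1
      have : walkLen ℓG s p = 0 := by omega
      rw [hP, this]; simp
    · have hL1 : 1 ≤ L := by
        rw [hL]
        exact_mod_cast h0
      have h5 : (n : ℝ) * P ≤ n * ((1 + ε) * L) := by nlinarith
      exact le_of_mul_le_mul_left h5 (by linarith)
  refine hgoal.trans (mul_le_mul_of_nonneg_left ?_ (by linarith))
  rw [hL]
  exact_mod_cast hle

theorem Wr_le (A lam J M r : ℕ) (hJ : 0 < J) (hlam : 0 < lam) (hM : 0 < M) :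
    Wr A lam J M r ≤ (4 * (J * (2 * lam * (24 * lam * A + 1)))) ^ r * M := by
  set Z := J * (2 * lam * (24 * lam * A + 1)) with hZ
  have hZ1 : 1 ≤ Z := by
    have : 0 < Z := by positivity
    omega
  have hJl : J * (2 * lam) ≤ Z := by
    rw [hZ]
    exact Nat.mul_le_mul_left _ (Nat.le_mul_of_pos_right _ (by omega))
  induction r with
  | zero => simp only [Wr, pow_zero, one_mul]; omega
  | succ r ih =>
    have e : Wr A lam J M (r + 1) = Z * Wr A lam J M r + 2 * (J * (2 * lam)) * M + 1 := by
      simp only [Wr, hZ]; ring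
    rw [e]
    set X := (4 * Z) ^ r with hX
    have hX1 : 1 ≤ X := Nat.one_le_pow _ _ (by omega)
    have a1 : Z * Wr A lam J M r ≤ Z * (X * M) := Nat.mul_le_mul_left _ ih
    have a0 : Z * M ≤ Z * (X * M) := Nat.mul_le_mul_left _ (Nat.le_mul_of_pos_left _ hX1)
    have a2 : 2 * (J * (2 * lam)) * M ≤ 2 * (Z * M) := by
      have := Nat.mul_le_mul_right M (Nat.mul_le_mul_left 2 hJl)
      rw [mul_assoc 2 Z M] at this
      exact this
    have a3 : 1 ≤ Z * M := Nat.mul_pos hZ1 hM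
    rw [pow_succ, ← hX]
    have : X * (4 * Z) * M = 4 * (Z * (X * M)) := by ring
    omega

end Final

section Asymp

theorem ev_log_pow (K s : ℝ) (hs : 0 < s) (m : ℕ) :
    ∀ᶠ n : ℕ in Filter.atTop, K * (Real.log n) ^ m ≤ (n : ℝ) ^ s := by
  have h := isLittleO_log_rpow_rpow_atTop (m : ℝ) hs
  have h1 := (h.const_mul_left K).bound (c := 1) one_pos
  have h2 := tendsto_natCast_atTop_atTop (R := ℝ) |>.eventually h1
  filter_upwards [h2, Filter.eventually_ge_atTop 1] with n hn hn1
  rw [Real.rpow_natCast, one_mul, Real.norm_of_nonneg (Real.rpow_nonneg (Nat.cast_nonneg n) s)] at hn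
  exact (le_abs_self _).trans hn

theorem final_bound (c ε : ℝ) (k b r n lam A M : ℕ) (hn8 : 8 ≤ n)
    (hr : 0 < r) (hrc : 1 / (r : ℝ) ≤ c / 2)
    (hlam : lam = Nat.log 2 n + 1) (hA : A = ⌈8 * ((lam : ℝ) + 2) / ε⌉₊)
    (hM : M = ⌈(n : ℝ) ^ (1 / (r : ℝ))⌉₊) (hε : 1 / (Real.logb 2 n) ^ b ≤ ε)
    (h1 : (2 * (4808 * ((k : ℝ) + 4) * 4 ^ (b + 4)) ^ r) * (Real.log n) ^ ((b + 4) * r)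
      ≤ (n : ℝ) ^ (c / 2))
    (h2 : (4 * 4 ^ b) * (Real.log n) ^ b ≤ (n : ℝ) ^ (1 : ℝ)) :
    0 < ε ∧ 4 ≤ ε * n ∧ 0 < A ∧ n < 2 ^ lam ∧ 8 * ((lam : ℝ) + 2) ≤ ε * A ∧ n ≤ M ^ r ∧
      (Wr A lam ((k + 4) * lam) M r : ℝ) ≤ (n : ℝ) ^ c := by
  have hnR : (8 : ℝ) ≤ n := by exact_mod_cast hn8
  have hn0 : (0 : ℝ) < n := by linarith
  have hl2 : 0 < Real.log 2 := Real.log_pos (by norm_num)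
  have hl2' : Real.log 2 < 1 := by linarith [Real.log_two_lt_d9]
  have hl2'' : 1 / 2 < Real.log 2 := by linarith [Real.log_two_gt_d9]
  have hlog8 : 3 * Real.log 2 ≤ Real.log n := by
    have : Real.log 8 = 3 * Real.log 2 := by
      rw [show (8 : ℝ) = 2 ^ 3 by norm_num, Real.log_pow]; norm_num
    rw [← this]
    exact Real.log_le_log (by norm_num) hnR
  have hlg3 : 3 ≤ Real.logb 2 n := by
    rw [Real.logb, le_div_iff₀ hl2]; exact hlog8
  have hlg2 : Real.logb 2 n ≤ 2 * Real.log n := by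
    rw [Real.logb, div_le_iff₀ hl2]; nlinarith
  have hlamlt : n < 2 ^ lam := by rw [hlam]; exact Nat.lt_pow_succ_log_self (by norm_num) n
  have hlgl : Real.logb 2 n ≤ lam := by
    rw [Real.logb, div_le_iff₀ hl2, ← Real.log_pow]
    exact Real.log_le_log hn0 (by exact_mod_cast hlamlt.le)
  have hlamle : (lam : ℝ) ≤ 4 * Real.log n := by
    have : (Nat.log 2 n : ℝ) ≤ Real.logb 2 n := by
      rw [Real.logb, le_div_iff₀ hl2, ← Real.log_pow]
      refine Real.log_le_log (by positivity) ?_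
      exact_mod_cast Nat.pow_log_le_self 2 (by omega)
    rw [hlam]; push_cast; nlinarith
  have hlam3 : (3 : ℝ) ≤ lam := hlg3.trans hlgl
  set x : ℝ := (lam : ℝ) with hx
  have hlgp : 0 < (Real.logb 2 n) ^ b := by positivity
  have hε0 : 0 < ε := lt_of_lt_of_le (by positivity) hε
  have hinv : 1 / ε ≤ (Real.logb 2 n) ^ b := by
    rw [div_le_iff₀ hε0]; rw [div_le_iff₀ hlgp] at hε; linarith
  have hinvx : 1 / ε ≤ x ^ b := hinv.trans (by gcongr)
  have hAge : 8 * (x + 2) / ε ≤ A := by rw [hA]; exact Nat.le_ceil _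
  have hApos : 0 < 8 * (x + 2) / ε := by positivity
  have hAub : (A : ℝ) ≤ 25 * x ^ (b + 1) := by
    have a1 : (A : ℝ) ≤ 8 * (x + 2) / ε + 1 := by rw [hA]; exact (Nat.ceil_lt_add_one hApos.le).le
    have a2 : 8 * (x + 2) / ε ≤ 8 * (x + 2) * x ^ b := by
      rw [div_eq_mul_one_div]; gcongr
    have a3 : 1 ≤ x ^ b := one_le_pow₀ (by linarith)
    rw [pow_succ]
    nlinarith
  have hMge : (n : ℝ) ^ (1 / (r : ℝ)) ≤ M := by rw [hM]; exact Nat.le_ceil _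
  have hone : (1 : ℝ) ≤ (n : ℝ) ^ (1 / (r : ℝ)) := Real.one_le_rpow (by linarith) (by positivity)
  have hM0 : 0 < M := by
    have : (0 : ℝ) < M := by linarith
    exact_mod_cast this
  have hMub : (M : ℝ) ≤ 2 * (n : ℝ) ^ (c / 2) := by
    have a1 : (M : ℝ) ≤ (n : ℝ) ^ (1 / (r : ℝ)) + 1 := by
      rw [hM]; exact (Nat.ceil_lt_add_one (by positivity)).le
    have a2 : (n : ℝ) ^ (1 / (r : ℝ)) ≤ (n : ℝ) ^ (c / 2) :=
      Real.rpow_le_rpow_of_exponent_le (by linarith) hrc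
    linarith
  have hlamN : 0 < lam := by rw [hlam]; omega
  refine ⟨hε0, ?_, ?_, hlamlt, ?_, ?_, ?_⟩
  · rw [Real.rpow_one] at h2
    have a1 : 4 * (Real.logb 2 n) ^ b ≤ n := by
      have : (Real.logb 2 n) ^ b ≤ (4 * Real.log n) ^ b := by
        gcongr
        exact hlgl.trans hlamle
      rw [mul_pow] at this
      linarith
    have a2 : 4 * (1 / ε) ≤ n := by linarith
    rw [mul_one_div, div_le_iff₀ hε0] at a2
    linarith
  · have : (0 : ℝ) < A := by linarith
    exact_mod_cast this
  · rw [div_le_iff₀ hε0] at hAge; linarith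
  · have : (n : ℝ) ≤ (M : ℝ) ^ r := by
      calc (n : ℝ) = ((n : ℝ) ^ (1 / (r : ℝ))) ^ r := by
            rw [← Real.rpow_natCast, ← Real.rpow_mul hn0.le, one_div,
              inv_mul_cancel₀ (by positivity), Real.rpow_one]
        _ ≤ _ := by gcongr
    exact_mod_cast this
  · have hW := Wr_le A lam ((k + 4) * lam) M r (by positivity) hlamN hM0
    have hW' : (Wr A lam ((k + 4) * lam) M r : ℝ) ≤
        (4 * (((k : ℝ) + 4) * x * (2 * x * (24 * x * A + 1)))) ^ r * M := by
      rw [hx]; exact_mod_cast hW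
    have hZ : 4 * (((k : ℝ) + 4) * x * (2 * x * (24 * x * A + 1))) ≤
        4808 * ((k : ℝ) + 4) * 4 ^ (b + 4) * (Real.log n) ^ (b + 4) := by
      have b1 : 24 * x * A + 1 ≤ 601 * x ^ (b + 2) := by
        have c1 : 1 ≤ x ^ (b + 2) := one_le_pow₀ (by linarith)
        have c2 : 24 * x * A ≤ 24 * x * (25 * x ^ (b + 1)) := by gcongr
        have c3 : 24 * x * (25 * x ^ (b + 1)) = 600 * x ^ (b + 2) := by ring
        linarith
      calc 4 * (((k : ℝ) + 4) * x * (2 * x * (24 * x * A + 1)))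
          ≤ 4 * (((k : ℝ) + 4) * x * (2 * x * (601 * x ^ (b + 2)))) := by gcongr
        _ = 4808 * ((k : ℝ) + 4) * x ^ (b + 4) := by ring
        _ ≤ 4808 * ((k : ℝ) + 4) * (4 * Real.log n) ^ (b + 4) := by gcongr
        _ = _ := by rw [mul_pow]; ring
    have hlogn : 0 ≤ Real.log n := by linarith
    calc (Wr A lam ((k + 4) * lam) M r : ℝ)
        ≤ (4 * (((k : ℝ) + 4) * x * (2 * x * (24 * x * A + 1)))) ^ r * M := hW'
      _ ≤ (4808 * ((k : ℝ) + 4) * 4 ^ (b + 4) * (Real.log n) ^ (b + 4)) ^ r *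
          (2 * (n : ℝ) ^ (c / 2)) := by gcongr
      _ = (2 * (4808 * ((k : ℝ) + 4) * 4 ^ (b + 4)) ^ r) * (Real.log n) ^ ((b + 4) * r) *
          (n : ℝ) ^ (c / 2) := by
          rw [mul_pow, ← pow_mul (Real.log n)]; ring
      _ ≤ (n : ℝ) ^ (c / 2) * (n : ℝ) ^ (c / 2) := by gcongr
      _ = (n : ℝ) ^ c := by rw [← Real.rpow_add hn0]; congr 1; ring

end Asymp

/-- For all `c > 0` and integers `k,b ≥ 1` there is `n₀` such
that every directed graph `G` on `n ≥ n₀` vertices with nonnegative integer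
edge lengths at most `n^k` admits, for every `ε` with `1/(log₂ n)^b ≤ ε < 1`, a
`(1+ε)`-distance-preserving DAG projection of width at most `n^c`; consequently
the projection has at most `n^{1+c}` vertices and at most `m·n^{2c}` edges. -/
theorem statement6 :
    ∀ c : ℝ, 0 < c → ∀ k b : ℕ, 1 ≤ k → 1 ≤ b →
    ∃ n₀ : ℕ, ∀ (VG : Type) (_ : Finite VG) (EG : VG → VG → Prop) (ℓG : VG → VG → ℕ),
      n₀ ≤ Nat.card VG →
      (∀ u v, EG u v → ℓG u v ≤ (Nat.card VG) ^ k) →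
      ∀ ε : ℝ, 1 / (Real.logb 2 (Nat.card VG)) ^ b ≤ ε → ε < 1 →
      ∃ (VD : Type) (_ : Finite VD) (ED : VD → VD → Prop) (ℓD : VD → VD → ℕ)
        (π : VD → VG),
        IsDag ED ∧
        (∀ x y, ED x y → EG (π x) (π y) ∧ ℓD x y = ℓG (π x) (π y)) ∧
        (∀ v : VG, ((π ⁻¹' {v}).ncard : ℝ) ≤ (Nat.card VG : ℝ) ^ c) ∧
        (∀ s t : VG,
          gdist EG ℓG s t ≤ gdistSet ED ℓD (π ⁻¹' {s}) (π ⁻¹' {t}) ∧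
          gdistSet ED ℓD (π ⁻¹' {s}) (π ⁻¹' {t}) ≤
            (1 + ENNReal.ofReal ε) * gdist EG ℓG s t) ∧
        ((Nat.card VD : ℝ) ≤ (Nat.card VG : ℝ) ^ (1 + c)) ∧
        (({p : VD × VD | ED p.1 p.2}.ncard : ℝ) ≤
          ({p : VG × VG | EG p.1 p.2}.ncard : ℝ) * (Nat.card VG : ℝ) ^ (2 * c)) := by
  intro c hc k b hk hb
  set r : ℕ := ⌈2 / c⌉₊ with hr
  have h2c : 0 < 2 / c := by positivity
  have hr0 : 0 < r := Nat.ceil_pos.2 h2c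
  have hrc : 1 / (r : ℝ) ≤ c / 2 := by
    have h : 2 / c ≤ (r : ℝ) := Nat.le_ceil _
    have h' := one_div_le_one_div_of_le h2c h
    rwa [one_div_div] at h'
  have e1 := ev_log_pow (2 * (4808 * ((k : ℝ) + 4) * 4 ^ (b + 4)) ^ r) (c / 2) (by positivity)
    ((b + 4) * r)
  have e2 := ev_log_pow (4 * 4 ^ b) 1 one_pos b
  obtain ⟨n₀, hn₀⟩ := Filter.eventually_atTop.1
    ((e1.and e2).and (Filter.eventually_ge_atTop 8))
  refine ⟨n₀, ?_⟩
  intro VG _ EG ℓG hcard hℓ ε hε hε1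
  obtain ⟨⟨h1, h2⟩, h8⟩ := hn₀ _ hcard
  obtain ⟨hε0, q1, q2, q3, q4, q5, q6⟩ := final_bound c ε k b r (Nat.card VG) _ _ _ h8 hr0 hrc
    rfl rfl rfl hε h1 h2
  obtain ⟨σ, s1, s2⟩ := exists_seq VG EG ℓG k (Nat.card VG) rfl (by omega) hℓ ε hε0 hε1 q1 _ _ _ r
    q2 q3 q4 q5
  exact dag_of_seq VG EG ℓG c ε hε0 (by omega) _ q6 σ s1 s2
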